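/- arXiv:1912.00555 — 12 statements merged into one kernel-verified Lean document; each statement's English description precedes it below -/
import Mathlib

section
/- For every real number d, s_d(1) = 1, s_d(2) = d, and for every integer n ≥ 3 the recurrence n·s_d(n) = (2d+1)·(2n−3)·s_d(n−1) − (n−3)·s_d(n−2) holds. -/
open scoped Classical

/-- `s(n,k)`: `s(1,0) = 1`, `s(1,k) = 0` for `k ≥ 1`, and
`s(n,k) = (1/(n-1)) * C(n-1,k) * C(n+k-1,n)` for `n ≥ 2`. -/
noncomputable def schroederS (n k : ℕ) : ℝ :=
  if n = 1 then (if k = 0 then 1 else 0)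
  else (1 / ((n : ℝ) - 1)) * ((n - 1).choose k) * ((n + k - 1).choose n)

/-- Weighted small Schröder number `s_d(n) = Σ_{k=0}^{n-1} s(n,k) d^k`. -/
noncomputable def sd (d : ℝ) (n : ℕ) : ℝ :=
  ∑ k ∈ Finset.range n, schroederS n k * d ^ k

lemma schroederS_zero_right {n : ℕ} (hn : 2 ≤ n) : schroederS n 0 = 0 := by
  simp [schroederS, Nat.choose_eq_zero_of_lt (show n - 1 < n by omega), show n ≠ 1 by omega]

lemma schroederS_eq_zero_of_le {n k : ℕ} (hn : 2 ≤ n) (hk : n ≤ k) : schroederS n k = 0 := by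
  simp [schroederS, Nat.choose_eq_zero_of_lt (show n - 1 < k by omega), show n ≠ 1 by omega]

lemma schroederS_eq_factorial (i j : ℕ) :
    schroederS (i + j + 2) (i + 1) = ((2 * i + j + 2).factorial : ℝ) /
      ((i + j + 2) * (i + j + 1) * ((i + 1).factorial * i.factorial * j.factorial)) := by
  have h₁ : ((i + j + 1).choose (i + 1) : ℝ) =
      (i + j + 1).factorial / ((i + 1).factorial * j.factorial) := by
    rw [Nat.cast_choose ℝ (by omega), show i + j + 1 - (i + 1) = j by omega]
  have h₂ : ((2 * i + j + 2).choose (i + j + 2) : ℝ) =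
      (2 * i + j + 2).factorial / ((i + j + 2).factorial * i.factorial) := by
    rw [Nat.cast_choose ℝ (by omega), show 2 * i + j + 2 - (i + j + 2) = i by omega]
  have h₃ : ((i + j + 2).factorial : ℝ) = (i + j + 2) * (i + j + 1).factorial := by
    rw [Nat.factorial_succ]; push_cast; ring
  rw [schroederS, if_neg (by omega), show i + j + 2 - 1 = i + j + 1 by omega,
    show i + j + 2 + (i + 1) - 1 = 2 * i + j + 2 by omega, h₁, h₂, h₃]
  push_cast
  rw [show (i : ℝ) + j + 2 - 1 = i + j + 1 by ring]
  field_simp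

/-- The four coefficients entering the recurrence, as multiples of a common factor. -/
lemma exists_schroederS_eq (m k : ℕ) : ∃ x : ℝ,
    schroederS (m + 4) (k + 1) = (m + k + 4) * (m + k + 3) * x / ((m + 4) * (m + 3)) ∧
    schroederS (m + 3) (k + 1) = (m + 2 - k) * (m + k + 3) * x / ((m + 3) * (m + 2)) ∧
    schroederS (m + 3) k = (k + 1) * k * x / ((m + 3) * (m + 2)) ∧
    schroederS (m + 2) (k + 1) = (m + 2 - k) * (m + 1 - k) * x / ((m + 2) * (m + 1)) := by
  rcases lt_or_ge (m + 2) k with hk | hk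
  · refine ⟨0, ?_, ?_, ?_, ?_⟩ <;> rw [schroederS_eq_zero_of_le (by omega) (by omega)] <;> simp
  obtain ⟨j, hj⟩ := Nat.exists_eq_add_of_le hk
  have hj' : (m : ℝ) = k + j - 2 := by
    have : (m : ℝ) + 2 = k + j := by exact_mod_cast hj
    linarith
  refine ⟨(m + k + 2).factorial / ((k + 1).factorial * k.factorial * j.factorial), ?_, ?_, ?_, ?_⟩
  · rw [show m + 4 = k + j + 2 by omega, schroederS_eq_factorial,
      show 2 * k + j + 2 = m + k + 2 + 1 + 1 by omega, Nat.factorial_succ, Nat.factorial_succ,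
      show (k : ℝ) + j = m + 2 by linarith]
    push_cast
    field_simp
    ring
  · rcases j with _ | j
    · rw [schroederS_eq_zero_of_le (by omega) (by omega), hj']
      simp
    · push_cast at hj'
      rw [show m + 3 = k + j + 2 by omega, schroederS_eq_factorial,
        show 2 * k + j + 2 = m + k + 2 + 1 by omega, Nat.factorial_succ, Nat.factorial_succ j,
        show (k : ℝ) + j = m + 1 by linarith, show (m : ℝ) + 2 - k = j + 1 by linarith]
      push_cast
      field_simp
      ring
  · rcases k with _ | k
    · rw [schroederS_zero_right (by omega)]
      simp
    · push_cast at hj'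
      rw [show m + 3 = k + j + 2 by omega, schroederS_eq_factorial,
        show 2 * k + j + 2 = m + (k + 1) + 2 by omega, Nat.factorial_succ (k + 1),
        Nat.factorial_succ k, show (k : ℝ) + j = m + 1 by linarith]
      push_cast
      field_simp
      ring
  · rcases j with _ | _ | j
    · rw [schroederS_eq_zero_of_le (by omega) (by omega), hj']
      simp
    · push_cast at hj'
      rw [schroederS_eq_zero_of_le (by omega) (by omega), show (m : ℝ) + 1 - k = 0 by linarith]
      simp
    · push_cast at hj'
      rw [show m + 2 = k + j + 2 by omega, schroederS_eq_factorial,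
        show 2 * k + j + 2 = m + k + 2 by omega, Nat.factorial_succ (j + 1), Nat.factorial_succ j,
        show (k : ℝ) + j = m by linarith, show (m : ℝ) + 2 - k = j + 2 by linarith,
        show (m : ℝ) + 1 - k = j + 1 by linarith]
      push_cast
      field_simp
      ring

lemma schroederS_recurrence (m k : ℕ) :
    (m + 4) * schroederS (m + 4) (k + 1) =
      (2 * m + 5) * (2 * schroederS (m + 3) k + schroederS (m + 3) (k + 1)) -
        (m + 1) * schroederS (m + 2) (k + 1) := by
  obtain ⟨x, h₁, h₂, h₃, h₄⟩ := exists_schroederS_eq m k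
  rw [h₁, h₂, h₃, h₄]
  field_simp
  ring

lemma sd_eq_sum_range (d : ℝ) {n N : ℕ} (hn : 2 ≤ n) (hN : n ≤ N) :
    sd d n = ∑ k ∈ Finset.range N, schroederS n k * d ^ k := by
  refine Finset.sum_subset (Finset.range_mono hN) fun k _ hk => ?_
  rw [schroederS_eq_zero_of_le hn (by simpa using hk), zero_mul]

lemma sd_eq_sum_range_succ (d : ℝ) {n N : ℕ} (hn : 2 ≤ n) (hN : n ≤ N + 1) :
    sd d n = ∑ k ∈ Finset.range N, schroederS n (k + 1) * d ^ (k + 1) := by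
  rw [sd_eq_sum_range d hn hN, Finset.sum_range_succ', schroederS_zero_right hn, zero_mul, add_zero]

/-- `s_d(1) = 1`, `s_d(2) = d`, and `n·s_d(n) = (2d+1)(2n−3)·s_d(n−1) − (n−3)·s_d(n−2)`
for all `n ≥ 3`. -/
theorem weighted_schroeder_recurrence (d : ℝ) :
    sd d 1 = 1 ∧ sd d 2 = d ∧
    ∀ n : ℕ, 3 ≤ n →
      (n : ℝ) * sd d n
        = (2 * d + 1) * (2 * (n : ℝ) - 3) * sd d (n - 1)
          - ((n : ℝ) - 3) * sd d (n - 2) := by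
  have h₂ : sd d 2 = d := by
    norm_num [sd, schroederS, Finset.sum_range_succ]
  refine ⟨by simp [sd, schroederS], h₂, fun n hn => ?_⟩
  obtain rfl | ⟨m, rfl⟩ : n = 3 ∨ ∃ m, n = m + 4 := by
    rcases hn.eq_or_lt with h | h
    · exact .inl h.symm
    · exact .inr ⟨n - 4, by omega⟩
  · have h₃ : sd d 3 = d + 2 * d ^ 2 := by
      norm_num [sd, schroederS, Finset.sum_range_succ, Nat.choose]
    norm_num [h₂, h₃]
    ring
  · have hd : d * sd d (m + 3) =
        ∑ k ∈ Finset.range (m + 3), schroederS (m + 3) k * d ^ (k + 1) := by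
      rw [sd, Finset.mul_sum]
      exact Finset.sum_congr rfl fun k _ => by ring
    have key : (m + 4) * sd d (m + 4) = (2 * m + 5) * (2 * (d * sd d (m + 3)) + sd d (m + 3)) -
        (m + 1) * sd d (m + 2) := by
      rw [hd, sd_eq_sum_range_succ d (N := m + 3) (n := m + 4) (by omega) (by omega),
        sd_eq_sum_range_succ d (N := m + 3) (n := m + 3) (by omega) (by omega),
        sd_eq_sum_range_succ d (N := m + 3) (n := m + 2) (by omega) (by omega)]
      simp only [Finset.mul_sum, ← Finset.sum_add_distrib, ← Finset.sum_sub_distrib]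
      refine Finset.sum_congr rfl fun k _ => ?_
      linear_combination d ^ (k + 1) * schroederS_recurrence m k
    rw [show m + 4 - 1 = m + 3 by omega, show m + 4 - 2 = m + 2 by omega]
    push_cast
    linear_combination key
end

section
/- For every integer m ≥ 1, s_{−1/2}(2m+1) = 0 and s_{−1/2}(2m) = ((−1)^m / 2^{2m−1}) · c(m). -/
open scoped Classical

open Polynomial in
/-- The sum `Σ_k C(N,k) C(N+k,j) d^k` as a polynomial coefficient. -/
theorem sum_choose_mul_choose_mul_pow_eq_coeff (d : ℝ) (N j : ℕ) :
    ∑ k ∈ Finset.range (N + 1), (N.choose k : ℝ) * ((N + k).choose j) * d ^ k =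
      ((1 + X : ℝ[X]) ^ N * (C d * (1 + X) + 1) ^ N).coeff j := by
  rw [add_pow (C d * (1 + X)), Finset.mul_sum, finsetSum_coeff]
  refine Finset.sum_congr rfl fun k _ => ?_
  have h : (1 + X : ℝ[X]) ^ N * ((C d * (1 + X)) ^ k * 1 ^ (N - k) * (N.choose k : ℝ[X])) =
      C (d ^ k * N.choose k) * (1 + X) ^ (N + k) := by
    simp only [C_mul, C_pow, map_natCast, one_pow, mul_pow]
    ring
  rw [h, coeff_C_mul, coeff_one_add_X_pow]
  ring

open Polynomial in
theorem sum_choose_mul_choose_mul_neg_half_pow (N j : ℕ) :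
    ∑ k ∈ Finset.range (N + 1), (N.choose k : ℝ) * ((N + k).choose j) * (-1 / 2) ^ k =
      (-1 / 2) ^ N * if 2 ∣ j then (-1) ^ (N - j / 2) * (N.choose (j / 2) : ℝ) else 0 := by
  have h : (1 + X : ℝ[X]) ^ N * (C (-1 / 2) * (1 + X) + 1) ^ N =
      C ((-1 / 2) ^ N) * expand ℝ 2 ((X + C (-1)) ^ N) := by
    have h2 : (1 : ℝ[X]) = C (-1 / 2) * (-2) := by
      rw [show (-2 : ℝ[X]) = C (-2) by rw [C_neg]; rfl, ← C_mul]
      norm_num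
    have h1 : C (-1 / 2) * (1 + X) + 1 = C (-1 / 2) * (X - 1 : ℝ[X]) := by
      linear_combination h2
    rw [h1, C_pow, map_pow, ← mul_pow, ← mul_pow]
    congr 1
    simp only [map_add, map_neg, map_one, expand_X]
    ring
  rw [sum_choose_mul_choose_mul_pow_eq_coeff, h, coeff_C_mul, coeff_expand two_pos,
    coeff_X_add_C_pow]

/-- Closed form of `s_{-1/2}(N+1)` for `N ≥ 1`. -/
theorem sd_neg_half_succ {N : ℕ} (hN : N ≠ 0) :
    sd (-1 / 2) (N + 1) = (1 / N) * ((-1 / 2) ^ N *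
      if 2 ∣ N + 1 then (-1) ^ (N - (N + 1) / 2) * (N.choose ((N + 1) / 2) : ℝ) else 0) := by
  rw [← sum_choose_mul_choose_mul_neg_half_pow, Finset.mul_sum, sd]
  refine Finset.sum_congr rfl fun k _ => ?_
  rw [schroederS, if_neg (by omega), show N + 1 + k - 1 = N + k by omega]
  push_cast
  rw [add_sub_cancel_right]
  ring

theorem choose_two_mul_add_one_succ_eq_mul_catalan (j : ℕ) :
    (2 * j + 1).choose (j + 1) = (2 * j + 1) * catalan j := by
  have h := Nat.add_one_mul_choose_eq (2 * j) j
  have hc := succ_mul_catalan_eq_centralBinom j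
  rw [Nat.centralBinom_eq_two_mul_choose] at hc
  apply Nat.eq_of_mul_eq_mul_right (Nat.succ_pos j)
  rw [← hc] at h
  linarith

/-- For every `m ≥ 1`: `s_{−1/2}(2m+1) = 0` and `s_{−1/2}(2m) = ((−1)^m / 2^{2m−1})·c(m)`,
where `c(m) = catalan (m−1)` is the `m`-th Catalan number. -/
theorem weighted_schroeder_neg_half (m : ℕ) (hm : 1 ≤ m) :
    sd (-1/2) (2 * m + 1) = 0 ∧
    sd (-1/2) (2 * m) = ((-1 : ℝ) ^ m / 2 ^ (2 * m - 1)) * (catalan (m - 1) : ℝ) := by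
  constructor
  · rw [sd_neg_half_succ (by omega), if_neg (by omega)]
    simp
  · obtain ⟨j, rfl⟩ := Nat.exists_eq_add_of_le' hm
    rw [show 2 * (j + 1) = (2 * j + 1) + 1 by ring, sd_neg_half_succ (by omega),
      if_pos (by omega), show (2 * j + 1 + 1) / 2 = j + 1 by omega,
      choose_two_mul_add_one_succ_eq_mul_catalan, show 2 * j + 1 - (j + 1) = j by omega,
      Nat.add_sub_cancel, Nat.add_sub_cancel, div_pow, Odd.neg_one_pow ⟨j, rfl⟩]
    have : (2 * j + 1 : ℝ) ≠ 0 := by positivity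
    push_cast
    field_simp
    ring
end

section
/- For every integer n ≥ 1, s_{−1}(n) = (−1)^{n−1}; equivalently, Σ_{0 ≤ k ≤ n−1, k odd} s(n,k) = Σ_{0 ≤ k ≤ n−1, k even} s(n,k) + (−1)^n. -/
open scoped Classical

/-- The `m`-th finite difference of `x ↦ C(x, m + 1)` at `m`, written as an alternating sum. -/
theorem alternating_sum_choose_mul_choose_add (m : ℕ) :
    ∑ k ∈ Finset.range (m + 1), (-1 : ℤ) ^ k * m.choose k * (m + k).choose (m + 1)
      = (-1) ^ m * m := by
  have h := congrFun (fwdDiff_iter_choose 1 m) m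
  rw [fwdDiff_iter_eq_sum_shift, Nat.choose_one_right] at h
  rw [← h, Finset.mul_sum]
  refine Finset.sum_congr rfl fun k hk => ?_
  obtain ⟨j, rfl⟩ := Nat.exists_eq_add_of_le (Finset.mem_range_succ_iff.mp hk)
  have hj : (-1 : ℤ) ^ j * (-1) ^ j = 1 := by rw [← mul_pow]; norm_num
  simp only [Nat.add_sub_cancel_left, smul_eq_mul, mul_one, pow_add]
  linear_combination (-(-1 : ℤ) ^ k * (k + j).choose k * (k + j + k).choose (k + j + 1)) * hj

theorem sd_neg_one (n : ℕ) (hn : 1 ≤ n) : sd (-1) n = (-1 : ℝ) ^ (n - 1) := by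
  obtain ⟨m, rfl⟩ := Nat.exists_eq_add_of_le' hn
  rcases Nat.eq_zero_or_pos m with rfl | hm
  · simp [sd, schroederS]
  have hm' : (m : ℝ) ≠ 0 := by positivity
  have h : ∑ k ∈ Finset.range (m + 1), (-1 : ℝ) ^ k * m.choose k * (m + k).choose (m + 1)
      = (-1) ^ m * m := by
    exact_mod_cast alternating_sum_choose_mul_choose_add m
  have hterm : ∀ k, schroederS (m + 1) k * (-1) ^ k
      = (1 / m) * ((-1 : ℝ) ^ k * m.choose k * (m + k).choose (m + 1)) := by
    intro k
    rw [schroederS, if_neg (by omega), show m + 1 + k - 1 = m + k by omega, Nat.add_sub_cancel]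
    push_cast
    rw [add_sub_cancel_right]
    ring
  rw [sd, Finset.sum_congr rfl fun k _ => hterm k, ← Finset.mul_sum, h, Nat.add_sub_cancel]
  field_simp

theorem sd_neg_one_eq_even_sub_odd (n : ℕ) :
    sd (-1) n = ∑ k ∈ (Finset.range n).filter (fun k => Even k), schroederS n k
      - ∑ k ∈ (Finset.range n).filter (fun k => Odd k), schroederS n k := by
  rw [sd, Finset.sum_filter, Finset.sum_filter, ← Finset.sum_sub_distrib]
  refine Finset.sum_congr rfl fun k _ => ?_
  rcases Nat.even_or_odd k with hk | hk
  · simp [hk, hk.neg_one_pow, Nat.not_odd_iff_even.mpr hk]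
  · simp [hk, hk.neg_one_pow, Nat.not_even_iff_odd.mpr hk]

/-- `s_{−1}(n) = (−1)^{n−1}`; equivalently
`Σ_{k odd} s(n,k) = Σ_{k even} s(n,k) + (−1)ⁿ`. -/
theorem weighted_schroeder_neg_one (n : ℕ) (hn : 1 ≤ n) :
    sd (-1) n = (-1 : ℝ) ^ (n - 1) ∧
    ∑ k ∈ (Finset.range n).filter (fun k => Odd k), schroederS n k
      = ∑ k ∈ (Finset.range n).filter (fun k => Even k), schroederS n k + (-1 : ℝ) ^ n := by
  have h := sd_neg_one n hn
  refine ⟨h, ?_⟩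
  have hpow : (-1 : ℝ) ^ n = -(-1) ^ (n - 1) := by
    obtain ⟨m, rfl⟩ := Nat.exists_eq_add_of_le' hn
    simp [pow_succ]
  linarith [sd_neg_one_eq_even_sub_odd n]
end

section
/- For every integer n ≥ 1, the small Schröder number s(n) = Σ_{k=0}^{n−1} s(n,k) is an odd integer; that is, there exists an odd integer m with s(n) = m. -/
open scoped Classical

/-- Summing subset-of-a-subset counts: choose the `j`-subset first, then any superset. -/
theorem sum_choose_mul_choose (m j : ℕ) (hj : j ≤ m) :
    ∑ k ∈ Finset.range (m + 1), m.choose k * k.choose j = m.choose j * 2 ^ (m - j) := by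
  obtain ⟨r, rfl⟩ := Nat.exists_eq_add_of_le hj
  rw [add_assoc, Finset.sum_range_add, Finset.sum_eq_zero, zero_add, Nat.add_sub_cancel_left,
    ← Nat.sum_range_choose, Finset.mul_sum]
  · refine Finset.sum_congr rfl fun i _ => ?_
    simpa using Nat.choose_mul (n := j + r) (k := j + i) (s := j) (by omega)
  · intro k hk
    rw [Nat.choose_eq_zero_of_lt (Finset.mem_range.mp hk), mul_zero]

/-- Integrality of the Narayana numbers. -/
theorem dvd_choose_mul_choose (m j : ℕ) :
    m ∣ m.choose j * m.choose (m + 1 - j) := by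
  rcases j with _ | i
  · simp
  rcases lt_or_ge m (i + 1) with h | h
  · simp [Nat.choose_eq_zero_of_lt h]
  obtain ⟨r, rfl⟩ : ∃ r, m = r + 1 := ⟨m - 1, by omega⟩
  have h₁ := Nat.add_one_mul_choose_eq r i
  have h₂ := Nat.add_one_mul_choose_eq r (r - i)
  obtain ⟨l, rfl⟩ : ∃ l, r = i + l := ⟨r - i, by omega⟩
  rw [show i + l + 1 + 1 - (i + 1) = l + 1 by omega]
  rw [show i + l - i = l by omega] at h₂
  set a := (i + l + 1).choose (i + 1)
  set b := (i + l + 1).choose (l + 1)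
  refine (Nat.dvd_add_right (dvd_mul_right (i + l + 1) (a * b))).mp
    ⟨(i + l).choose i * b + (i + l).choose l * a, ?_⟩
  linear_combination b * h₁.symm + a * h₂.symm

/-- The small Schröder numbers in terms of Narayana numbers, with denominators cleared. -/
theorem sum_choose_mul_choose_add (m : ℕ) :
    ∑ k ∈ Finset.range (m + 1), m.choose k * (m + k).choose (m + 1) =
      ∑ j ∈ Finset.range (m + 1), m.choose j * m.choose (m + 1 - j) * 2 ^ (m - j) := by
  have vandermonde : ∀ k ∈ Finset.range (m + 1), m.choose k * (m + k).choose (m + 1) =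
      ∑ j ∈ Finset.range (m + 1), m.choose k * k.choose j * m.choose (m + 1 - j) := by
    intro k hk
    rw [add_comm m k, Nat.add_choose_eq,
      Finset.Nat.sum_antidiagonal_eq_sum_range_succ_mk, Finset.sum_range_succ,
      Nat.choose_eq_zero_of_lt (Finset.mem_range.mp hk), zero_mul, add_zero, Finset.mul_sum]
    simp only [mul_assoc]
  rw [Finset.sum_congr rfl vandermonde, Finset.sum_comm]
  refine Finset.sum_congr rfl fun j hj => ?_
  rw [← Finset.sum_mul, sum_choose_mul_choose m j (Finset.mem_range_succ_iff.mp hj)]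
  ring

theorem exists_sum_choose_mul_choose_add_eq (m : ℕ) :
    ∃ t : ℕ, ∑ k ∈ Finset.range (m + 1), m.choose k * (m + k).choose (m + 1) =
      m * (2 * t + 1) := by
  have hdvd : m * 2 ∣
      ∑ j ∈ Finset.range m, m.choose j * m.choose (m + 1 - j) * 2 ^ (m - j) :=
    Finset.dvd_sum fun j hj => mul_dvd_mul (dvd_choose_mul_choose m j)
      (dvd_pow_self 2 (Nat.sub_ne_zero_of_lt (Finset.mem_range.mp hj)))
  obtain ⟨t, ht⟩ := hdvd
  refine ⟨t, ?_⟩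
  rw [sum_choose_mul_choose_add, Finset.sum_range_succ, ht]
  simp
  ring

/-- The small Schröder number `s(n) = Σ_{k=0}^{n−1} s(n,k)` is an odd integer. -/
theorem small_schroeder_odd (n : ℕ) (hn : 1 ≤ n) :
    ∃ m : ℤ, Odd m ∧ ∑ k ∈ Finset.range n, schroederS n k = (m : ℝ) := by
  obtain ⟨m, rfl⟩ : ∃ m, n = m + 1 := ⟨n - 1, by omega⟩
  rcases Nat.eq_zero_or_pos m with rfl | hm
  · exact ⟨1, odd_one, by simp [schroederS]⟩
  obtain ⟨t, ht⟩ := exists_sum_choose_mul_choose_add_eq m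
  refine ⟨2 * t + 1, ⟨t, rfl⟩, ?_⟩
  have hm' : (m : ℝ) ≠ 0 := by positivity
  have hterm : ∀ k ∈ Finset.range (m + 1), schroederS (m + 1) k =
      1 / (m : ℝ) * ((m.choose k * (m + k).choose (m + 1) : ℕ) : ℝ) := by
    intro k _
    rw [schroederS, if_neg (by omega), show m + 1 + k - 1 = m + k by omega]
    simp [mul_assoc]
  rw [Finset.sum_congr rfl hterm, ← Finset.mul_sum, ← Nat.cast_sum, ht]
  push_cast
  field_simp
end

section
/- For every odd positive integer d and every integer n ≥ 1, the weighted small Schröder number s_d(n) is an odd integer; that is, there exists an odd integer m with s_d(n) = m. -/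
open scoped Classical

open Finset in
/-- The alternating binomial sum computing the `m`-th forward difference of `x ↦ C(x, p)`. -/
lemma sum_alternating_choose_shift (m p x : ℕ) :
    ∑ i ∈ range (m + 1), (-1 : ℤ) ^ (m - i) * m.choose i * (x + i).choose p =
      if m ≤ p then (x.choose (p - m) : ℤ) else 0 := by
  have h := fwdDiff_iter_eq_sum_shift (1 : ℕ) (fun y : ℕ ↦ (y.choose p : ℤ)) m x
  simp only [smul_eq_mul, mul_one] at h
  rw [← h]
  split_ifs with hmp
  · obtain ⟨j, rfl⟩ := Nat.exists_eq_add_of_le hmp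
    rw [fwdDiff_iter_choose, Nat.add_sub_cancel_left]
  · obtain ⟨k, rfl⟩ := Nat.exists_eq_add_of_lt (not_le.mp hmp)
    rw [show p + k + 1 = (k + 1) + p by ring, Function.iterate_add_apply]
    have h0 := fwdDiff_iter_choose 0 p
    rw [add_zero] at h0
    simp_rw [h0, Nat.choose_zero_right, Function.iterate_succ_apply, fwdDiff_const,
      fwdDiff_iter_eq_sum_shift, smul_zero, sum_const_zero]

open Finset in
lemma sum_alternating_choose_mul_choose (M k : ℕ) (hk : k ≤ M + 1) :
    ∑ j ∈ range (M + 2), (-1 : ℤ) ^ (M + 1 - j) * (M + 1).choose j *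
        (M + 1 + j).choose M * j.choose k =
      (M + 1).choose k * (M + 1 + k).choose (M + 2) := by
  obtain ⟨m, hm⟩ := Nat.exists_eq_add_of_le hk
  rw [show M + 2 = k + (m + 1) by lia, sum_range_add, sum_eq_zero, zero_add]
  · have h := sum_alternating_choose_shift m M (M + 1 + k)
    have hr : ((M + 1 + k).choose (k + (m + 1)) : ℤ) =
        if m ≤ M then ((M + 1 + k).choose (M - m) : ℤ) else 0 := by
      split_ifs with hmM
      · rw [Nat.choose_symm_of_eq_add (by lia : M + 1 + k = k + (m + 1) + (M - m))]
      · rw [Nat.choose_eq_zero_of_lt (by lia), Nat.cast_zero]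
    rw [hr, ← h, mul_sum]
    refine sum_congr rfl fun i _ ↦ ?_
    have hc := Nat.choose_mul (n := M + 1) (Nat.le_add_right k i)
    rw [Nat.add_sub_cancel_left, show M + 1 - k = m by lia] at hc
    rw [show M + 1 - (k + i) = m - i by lia, ← add_assoc]
    have hz : ((M + 1).choose (k + i) : ℤ) * (k + i).choose k =
        (M + 1).choose k * m.choose i := mod_cast hc
    linear_combination (-1 : ℤ) ^ (m - i) * (M + 1 + k + i).choose M * hz
  · intro j hj
    rw [Nat.choose_eq_zero_of_lt (mem_range.mp hj), Nat.cast_zero, mul_zero]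

lemma mul_catalan_mul_choose (M j : ℕ) :
    (M + 1) * (catalan j * (M + 1 + j).choose (2 * j)) =
      (M + 1).choose j * (M + 1 + j).choose M := by
  have h1 := succ_mul_catalan_eq_centralBinom j
  rw [Nat.centralBinom_eq_two_mul_choose] at h1
  have h2 := Nat.choose_mul (n := M + 1 + j) (by lia : j ≤ 2 * j)
  rw [Nat.add_sub_cancel, show 2 * j - j = j by lia] at h2
  have h3 := Nat.choose_succ_right_eq (M + 1 + j) j
  rw [Nat.add_sub_cancel,
    Nat.choose_symm_of_eq_add (by lia : M + 1 + j = j + 1 + M)] at h3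
  refine Nat.eq_of_mul_eq_mul_left (Nat.succ_pos j) ?_
  calc (j + 1) * ((M + 1) * (catalan j * (M + 1 + j).choose (2 * j)))
      = (M + 1) * ((M + 1 + j).choose (2 * j) * ((j + 1) * catalan j)) := by ring
    _ = ((M + 1 + j).choose j * (M + 1)) * (M + 1).choose j := by rw [h1, h2]; ring
    _ = (j + 1) * ((M + 1).choose j * (M + 1 + j).choose M) := by rw [← h3]; ring

/-- The expansion of `s_d(N + 1)` in powers of `d + 1`, with signed Catalan weights. -/
def catalanExpansion (d : ℤ) (N : ℕ) : ℤ :=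
  ∑ j ∈ Finset.range (N + 1),
    (-1) ^ (N - j) * (catalan j * (N + j).choose (2 * j)) * (d + 1) ^ j

lemma odd_catalanExpansion {d : ℤ} (hd : Odd d) (N : ℕ) : Odd (catalanExpansion d N) := by
  rw [catalanExpansion, Finset.sum_range_succ']
  refine Even.add_odd (Finset.even_sum _ fun j _ ↦ ?_) ?_
  · exact ((hd.add_one).pow_of_ne_zero (Nat.succ_ne_zero j)).mul_left _
  · simpa using (odd_neg_one (α := ℤ)).pow

open Finset in
lemma mul_catalanExpansion (d : ℤ) (M : ℕ) :
    (M + 1) * catalanExpansion d (M + 1) =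
      ∑ k ∈ range (M + 2), ((M + 1).choose k * (M + 1 + k).choose (M + 2) : ℤ) * d ^ k := by
  have hpow (j : ℕ) (hj : j ∈ range (M + 2)) :
      (d + 1) ^ j = ∑ k ∈ range (M + 2), (j.choose k : ℤ) * d ^ k := by
    rw [add_pow]
    refine (sum_congr rfl fun k _ ↦ ?_).trans
      (sum_subset (range_subset_range.mpr (mem_range.mp hj)) fun k _ hk ↦ ?_)
    · rw [one_pow, mul_one, mul_comm]
    · rw [Nat.choose_eq_zero_of_lt (by simpa using hk), Nat.cast_zero, zero_mul]
  calc (M + 1) * catalanExpansion d (M + 1)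
      = ∑ j ∈ range (M + 2), ∑ k ∈ range (M + 2), (-1 : ℤ) ^ (M + 1 - j) *
          (M + 1).choose j * (M + 1 + j).choose M * j.choose k * d ^ k := by
        rw [catalanExpansion, mul_sum]
        refine sum_congr rfl fun j hj ↦ ?_
        have h : ((M : ℤ) + 1) * (catalan j * (M + 1 + j).choose (2 * j)) =
            (M + 1).choose j * (M + 1 + j).choose M := mod_cast mul_catalan_mul_choose M j
        simp only [mul_assoc, ← mul_sum, ← hpow j hj]
        linear_combination (-1 : ℤ) ^ (M + 1 - j) * (d + 1) ^ j * h
    _ = _ := by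
        rw [sum_comm]
        refine sum_congr rfl fun k hk ↦ ?_
        rw [← sum_mul, sum_alternating_choose_mul_choose M k
          (Nat.lt_succ_iff.mp (mem_range.mp hk))]

lemma sd_eq_catalanExpansion (d : ℤ) (N : ℕ) : sd d (N + 1) = catalanExpansion d N := by
  cases N with
  | zero => simp [sd, schroederS, catalanExpansion]
  | succ M =>
    have hM : (M : ℝ) + 1 ≠ 0 := by positivity
    have h : ((M : ℝ) + 1) * catalanExpansion d (M + 1) = ∑ k ∈ Finset.range (M + 2),
        ((M + 1).choose k * (M + 1 + k).choose (M + 2) : ℝ) * (d : ℝ) ^ k :=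
      mod_cast mul_catalanExpansion d M
    rw [← mul_right_inj' hM, h, sd, Finset.mul_sum]
    refine Finset.sum_congr rfl fun k _ ↦ ?_
    rw [schroederS, if_neg (by lia), show M + 1 + 1 + k - 1 = M + 1 + k by lia]
    simp only [Nat.add_sub_cancel]
    push_cast
    field_simp
    ring

/-- For every odd positive integer `d` and every `n ≥ 1`, `s_d(n)` is an odd integer. -/
theorem weighted_schroeder_odd (d : ℤ) (hd : 0 < d) (hodd : Odd d) (n : ℕ) (hn : 1 ≤ n) :
    ∃ m : ℤ, Odd m ∧ sd (d : ℝ) n = (m : ℝ) := by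
  obtain ⟨N, rfl⟩ := Nat.exists_eq_add_of_le' hn
  exact ⟨catalanExpansion d N, odd_catalanExpansion hodd N, sd_eq_catalanExpansion d N⟩
end

section
/- For every real number d ≠ −1 and every integer n ≥ 2, s_d(n) = ((−1)^{n−1}·d/(d+1))·s_{−d−1}(n). -/
open scoped Classical

open Polynomial in
/-- The weighted Schröder number in terms of the derivative of a shifted Legendre polynomial. -/
lemma sd_mul_eq_aeval_derivative_shiftedLegendre (d : ℝ) {N : ℕ} (hN : N ≠ 0) :
    sd d (N + 1) * (N * (N + 1)) = -d * aeval (-d) (derivative (shiftedLegendre N)) := by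
  have hN' : (N : ℝ) ≠ 0 := Nat.cast_ne_zero.mpr hN
  rw [sd, shiftedLegendre, derivative_sum, map_sum, Finset.sum_mul, Finset.mul_sum]
  refine Finset.sum_congr rfl fun k _ => ?_
  rw [derivative_C_mul_X_pow]
  rcases k with _ | k
  · simp [schroederS, hN]
  · have h : ((N + (k + 1)).choose (N + 1) : ℝ) * (N + 1) =
        ((N + (k + 1)).choose N : ℝ) * (k + 1) := by
      have := Nat.choose_succ_right_eq (N + (k + 1)) N
      rw [Nat.add_sub_cancel_left] at this
      exact_mod_cast this
    have hs : (-1 : ℝ) ^ (k + 1) * (-d) ^ (k + 1) = d ^ (k + 1) := by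
      rw [← mul_pow]; simp
    have hi : N + 1 + (k + 1) - 1 = N + (k + 1) := by omega
    rw [map_mul, aeval_C, map_pow, aeval_X]
    simp only [schroederS, Nat.add_eq_right, hN, if_false, hi, Nat.add_sub_cancel, eq_intCast,
      algebraMap_int_eq, Nat.cast_add, Nat.cast_one, add_sub_cancel_right]
    push_cast
    field_simp
    rw [← hs]
    linear_combination (N.choose (k + 1) : ℝ) * ((-1) ^ (k + 1) * (-d) ^ (k + 1)) * h

open Polynomial in
/-- The derivative of a shifted Legendre polynomial inherits its symmetry about `1 / 2`. -/
lemma aeval_derivative_shiftedLegendre_symm (N : ℕ) (x : ℝ) :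
    aeval x (derivative (shiftedLegendre N)) =
      -((-1) ^ N * aeval (1 - x) (derivative (shiftedLegendre N))) := by
  have h := congrArg (fun p => aeval x (derivative p))
    (neg_one_pow_mul_shiftedLegendre_comp_one_sub_X_eq N)
  rw [← h, show ((-1 : ℤ[X]) ^ N) = C ((-1) ^ N) by simp, derivative_C_mul, derivative_comp]
  simp [aeval_comp]

/-- For `d ≠ −1` and `n ≥ 2`, `s_d(n) = ((−1)^{n−1}·d/(d+1))·s_{−d−1}(n)`. -/
theorem weighted_schroeder_reflection (d : ℝ) (hd : d ≠ -1) (n : ℕ) (hn : 2 ≤ n) :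
    sd d n = ((-1 : ℝ) ^ (n - 1) * d / (d + 1)) * sd (-d - 1) n := by
  obtain ⟨N, rfl⟩ : ∃ N, n = N + 1 := ⟨n - 1, by omega⟩
  have hN : N ≠ 0 := by omega
  have hd' : d + 1 ≠ 0 := fun h => hd (by linarith)
  have hc : (N : ℝ) * (N + 1) ≠ 0 := by positivity
  have h₁ := sd_mul_eq_aeval_derivative_shiftedLegendre d hN
  have h₂ := sd_mul_eq_aeval_derivative_shiftedLegendre (-d - 1) hN
  rw [aeval_derivative_shiftedLegendre_symm, show 1 - -d = -(-d - 1) by ring] at h₁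
  rw [Nat.add_sub_cancel]
  apply mul_right_cancel₀ hc
  rw [mul_assoc, h₁, h₂]
  field_simp
  ring
end

section
/- For every integer n ≥ 2 and every integer j with 0 ≤ j ≤ n−1, one has (1/n)·C(n, j+1)·C(n+j−1, n−1) = s(n,j) + s(n,j+1). -/
open scoped Classical

/-- For `n ≥ 2` and `0 ≤ j ≤ n−1`:
`(1/n)·C(n,j+1)·C(n+j−1,n−1) = s(n,j) + s(n,j+1)`. -/
theorem schroeder_triangle_sum (n j : ℕ) (hn : 2 ≤ n) (hj : j ≤ n - 1) :
    (1 / (n : ℝ)) * (n.choose (j + 1)) * ((n + j - 1).choose (n - 1))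
      = schroederS n j + schroederS n (j + 1) := by
  obtain ⟨m, rfl⟩ : ∃ m, n = m + 2 := ⟨n - 2, by omega⟩
  have hj' : j ≤ m + 1 := by omega
  have hQ : ((m + j + 1).choose (m + 2) : ℝ) * (m + 2) = (m + j + 1).choose (m + 1) * j := by
    have h := Nat.choose_succ_right_eq (m + j + 1) (m + 1)
    rw [show m + j + 1 - (m + 1) = j by omega] at h
    exact_mod_cast h
  have hB : ((m + 1).choose (j + 1) : ℝ) * (j + 1) = (m + 1).choose j * (m + 1 - j) := by
    have h := congrArg (Nat.cast (R := ℝ)) (Nat.choose_succ_right_eq (m + 1) j)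
    push_cast [Nat.cast_sub hj'] at h
    exact h
  have hm1 : (m : ℝ) + 1 ≠ 0 := by positivity
  have hm2 : (m : ℝ) + 2 ≠ 0 := by positivity
  unfold schroederS
  rw [if_neg (by omega), if_neg (by omega), show m + 2 + j - 1 = m + j + 1 by omega,
    show m + 2 + (j + 1) - 1 = (m + j + 1) + 1 by omega, show m + 2 - 1 = m + 1 by omega,
    Nat.choose_succ_succ' (m + 1) j, Nat.choose_succ_succ' (m + j + 1) (m + 1)]
  push_cast
  rw [show (m : ℝ) + 2 - 1 = m + 1 by ring]
  generalize ((m + 1).choose j : ℝ) = A at *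
  generalize ((m + 1).choose (j + 1) : ℝ) = B at *
  generalize ((m + j + 1).choose (m + 1) : ℝ) = P at *
  rw [show m + 1 + 1 = m + 2 by rfl]
  generalize ((m + j + 1).choose (m + 2) : ℝ) = Q at *
  field_simp
  linear_combination (-(A + B)) * hQ - P * hB
end

section
/- For every real number d and every integer n ≥ 2, s_d(n) = (1/n)·Σ_{i=0}^{n−1} (−1)^i·C(n,i)·C(2n−i−2, n−1)·(d+1)^{n−1−i}. -/
open scoped Classical

open Finset in
/-- Pascal's rule for alternating binomial sums. -/
theorem sum_range_alternating_choose_succ (f : ℕ → ℝ) (n : ℕ) :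
    ∑ i ∈ range (n + 2), (-1 : ℝ) ^ i * ((n + 1).choose i) * f i
      = ∑ i ∈ range (n + 1), (-1 : ℝ) ^ i * (n.choose i) * f i
        - ∑ i ∈ range (n + 1), (-1 : ℝ) ^ i * (n.choose i) * f (i + 1) := by
  have h : ∑ i ∈ range (n + 1), (-1 : ℝ) ^ i * (n.choose i) * f i
      = ∑ i ∈ range (n + 1), (-1 : ℝ) ^ (i + 1) * (n.choose (i + 1)) * f (i + 1) + f 0 := by
    rw [sum_range_succ' _ n, sum_range_succ _ n]
    simp
  rw [sum_range_succ', h, add_sub_right_comm, ← sum_sub_distrib]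
  simp only [pow_zero, Nat.choose_zero_right, Nat.cast_one, one_mul, add_left_inj]
  refine sum_congr rfl fun i _ => ?_
  rw [Nat.choose_succ_succ, Nat.cast_add]
  ring

open Finset in
theorem sum_range_alternating_choose_mul_choose_add (n M r : ℕ) :
    ∑ i ∈ range (n + 1), (-1 : ℝ) ^ i * (n.choose i) * ((M + n - i).choose (r + n))
      = M.choose r := by
  induction n generalizing M r with
  | zero => simp
  | succ n ih =>
    rw [sum_range_alternating_choose_succ
      (fun i => (((M + (n + 1) - i).choose (r + (n + 1)) : ℕ) : ℝ))]
    have h₁ := ih (M + 1) (r + 1)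
    have h₂ := ih M (r + 1)
    simp only [show ∀ i, M + 1 + n - (i + 1) = M + n - i by omega,
      show r + (n + 1) = r + 1 + n by omega, show M + (n + 1) = M + 1 + n by omega]
    rw [h₁, h₂, Nat.choose_succ_succ, Nat.cast_add]
    ring

open Finset in
theorem sum_range_alternating_choose_mul_choose_eq_zero (n M : ℕ) :
    ∑ i ∈ range (n + 2), (-1 : ℝ) ^ i * ((n + 1).choose i) * ((M + (n + 1) - i).choose n)
      = 0 := by
  rw [sum_range_alternating_choose_succ (fun i => (((M + (n + 1) - i).choose n : ℕ) : ℝ))]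
  have h₁ := sum_range_alternating_choose_mul_choose_add n (M + 1) 0
  have h₂ := sum_range_alternating_choose_mul_choose_add n M 0
  simp only [zero_add, Nat.choose_zero_right] at h₁ h₂
  simp only [show ∀ i, M + 1 + n - (i + 1) = M + n - i by omega,
    show M + (n + 1) = M + 1 + n by omega]
  rw [h₁, h₂, sub_self]

theorem choose_mul_choose_sub_eq (m a k : ℕ) :
    m.choose a * (m - a).choose k = m.choose (a + k) * (a + k).choose k := by
  rw [← Nat.choose_symm_add, Nat.choose_mul (Nat.le_add_right a k), Nat.add_sub_cancel_left]

theorem add_one_pow_eq_sum_range_of_lt (d : ℝ) {p N : ℕ} (h : p < N) :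
    (d + 1) ^ p = ∑ k ∈ Finset.range N, (p.choose k : ℝ) * d ^ k := by
  rw [add_pow]
  simp only [one_pow, mul_one]
  refine (Finset.sum_subset (Finset.range_mono h) fun k _ hk => ?_).trans
    (Finset.sum_congr rfl fun k _ => mul_comm _ _)
  rw [Nat.choose_eq_zero_of_lt (by simpa using hk), Nat.cast_zero, mul_zero]

theorem schroederS_eq_alternating_sum (m k : ℕ) :
    schroederS (m + 2) k = (1 / ((m + 2 : ℕ) : ℝ)) *
      ∑ i ∈ Finset.range (m + 2), (-1 : ℝ) ^ i * ((m + 2).choose i) *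
        ((2 * (m + 2) - i - 2).choose (m + 1)) * ((m + 1 - i).choose k) := by
  have hterm : ∀ i ∈ Finset.range (m + 2), (-1 : ℝ) ^ i * ((m + 2).choose i) *
        ((2 * (m + 2) - i - 2).choose (m + 1)) * ((m + 1 - i).choose k)
      = (-1 : ℝ) ^ i * ((m + 2).choose i) * ((m + (m + 2) - i).choose (m + 1 + k)) *
        ((m + 1 + k).choose k) := fun i _ => by
    have h := choose_mul_choose_sub_eq (m + (m + 2) - i) (m + 1) k
    rw [show m + (m + 2) - i - (m + 1) = m + 1 - i by omega] at h
    rw [show 2 * (m + 2) - i - 2 = m + (m + 2) - i by omega, mul_assoc, mul_assoc (_ * _)]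
    exact_mod_cast congrArg (fun x : ℕ => (-1 : ℝ) ^ i * ((m + 2).choose i) * x) h
  rw [Finset.sum_congr rfl hterm, ← Finset.sum_mul]
  have hlast : ∑ i ∈ Finset.range (m + 2), (-1 : ℝ) ^ i * ((m + 2).choose i) *
        ((m + (m + 2) - i).choose (m + 1 + k))
      = ∑ i ∈ Finset.range (m + 2 + 1), (-1 : ℝ) ^ i * ((m + 2).choose i) *
        ((m + (m + 2) - i).choose (m + 1 + k)) := by
    rw [Finset.sum_range_succ _ (m + 2),
      Nat.choose_eq_zero_of_lt (show m + (m + 2) - (m + 2) < m + 1 + k by omega)]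
    simp
  rw [hlast, schroederS, if_neg (by omega)]
  cases k with
  | zero =>
    have h := sum_range_alternating_choose_mul_choose_eq_zero (m + 1) m
    rw [add_zero, h, Nat.choose_eq_zero_of_lt (show m + 2 + 0 - 1 < m + 2 by omega)]
    simp
  | succ j =>
    have h := sum_range_alternating_choose_mul_choose_add (m + 2) m j
    rw [show m + 1 + (j + 1) = j + (m + 2) by omega, h,
      show m + 2 + (j + 1) - 1 = j + (m + 2) by omega, show m + 2 - 1 = m + 1 by omega]
    have h₁ : ((m : ℝ) + 1) * m.choose j = (m + 1).choose (j + 1) * (j + 1) := by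
      exact_mod_cast Nat.add_one_mul_choose_eq m j
    have h₂ : ((j + (m + 2)).choose (j + 1) : ℝ) * (j + 1)
        = (j + (m + 2)).choose (m + 2) * (m + 2) := by
      have h := Nat.choose_succ_right_eq (j + (m + 2)) j
      rw [Nat.add_sub_cancel_left, Nat.choose_symm_add] at h
      exact_mod_cast h
    have hj : (j : ℝ) + 1 ≠ 0 := by positivity
    have hm : (m : ℝ) + 1 ≠ 0 := by positivity
    push_cast
    rw [show (m : ℝ) + 2 - 1 = m + 1 by ring]
    field_simp
    apply mul_left_cancel₀ hj
    linear_combination (-((j + (m + 2)).choose (m + 2) : ℝ) * (m + 2)) * h₁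
      - (m + 1) * (m.choose j : ℝ) * h₂

/-- For `n ≥ 2`:
`s_d(n) = (1/n)·Σ_{i=0}^{n−1} (−1)ⁱ·C(n,i)·C(2n−i−2,n−1)·(d+1)^{n−1−i}`. -/
theorem weighted_schroeder_lagrange (d : ℝ) (n : ℕ) (hn : 2 ≤ n) :
    sd d n
      = (1 / (n : ℝ)) *
          ∑ i ∈ Finset.range n,
            (-1 : ℝ) ^ i * (n.choose i) * ((2 * n - i - 2).choose (n - 1)) *
              (d + 1) ^ (n - 1 - i) := by
  obtain ⟨m, rfl⟩ := Nat.exists_eq_add_of_le' hn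
  rw [sd, Finset.mul_sum]
  simp only [schroederS_eq_alternating_sum, Finset.mul_sum, Finset.sum_mul]
  rw [Finset.sum_comm]
  refine Finset.sum_congr rfl fun i _ => ?_
  rw [add_one_pow_eq_sum_range_of_lt d (show m + 2 - 1 - i < m + 2 by omega), Finset.mul_sum,
    Finset.mul_sum]
  refine Finset.sum_congr rfl fun k _ => ?_
  rw [show m + 2 - 1 = m + 1 by omega]
  ring
end

section
/- For every real number d and every integer n ≥ 1, s_d(n) = Σ_{P ∈ D_n} d^{U_V(P)}·(d+1)^{V(P)}, where the sum is over all Dyck paths in D_n. -/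
open scoped Classical

/-- A Dyck path of length `m`, encoded as `P : Fin m → Bool` with `true` = up step `U`
and `false` = down step `D`: equal numbers of up and down steps, and every prefix has
at least as many up steps as down steps. -/
def IsDyck {m : ℕ} (P : Fin m → Bool) : Prop :=
  2 * (Finset.univ.filter fun i => P i = true).card = m ∧
  ∀ j : Fin m,
    (Finset.univ.filter fun i => i ≤ j ∧ P i = false).card ≤
      (Finset.univ.filter fun i => i ≤ j ∧ P i = true).card

/-- `V(P)`: number of valleys (a down step immediately followed by an up step). -/
noncomputable def valleys {m : ℕ} (P : Fin m → Bool) : ℕ :=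
  (Finset.univ.filter fun i : Fin m =>
    (if h : (i : ℕ) + 1 < m then !(P i) && P ⟨(i : ℕ) + 1, h⟩ else false) = true).card

/-- `K(P)`: number of peaks (an up step immediately followed by a down step). -/
noncomputable def peaks {m : ℕ} (P : Fin m → Bool) : ℕ :=
  (Finset.univ.filter fun i : Fin m =>
    (if h : (i : ℕ) + 1 < m then P i && !(P ⟨(i : ℕ) + 1, h⟩) else false) = true).card

/-- Every prefix has at least as many up steps as down steps. -/
def IsBallot {m : ℕ} (P : Fin m → Bool) : Prop :=
  ∀ j : Fin m,
    (Finset.univ.filter fun i => i ≤ j ∧ P i = false).card ≤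
      (Finset.univ.filter fun i => i ≤ j ∧ P i = true).card

/-- The number of up steps. -/
def ups {m : ℕ} (P : Fin m → Bool) : ℕ :=
  (Finset.univ.filter fun i => P i = true).card

/-- The last step exists and is a down step. -/
def EndsDown {m : ℕ} (P : Fin m → Bool) : Prop :=
  ∃ i : Fin m, (i : ℕ) + 1 = m ∧ P i = false

theorem card_filter_false_add_ups {m : ℕ} (P : Fin m → Bool) :
    (Finset.univ.filter fun i => P i = false).card + ups P = m := by
  have h := Finset.card_filter_add_card_filter_not (s := (Finset.univ : Finset (Fin m)))
    (fun i => P i = false)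
  simpa [ups] using h

theorem ups_snoc {m : ℕ} (P : Fin m → Bool) (s : Bool) :
    ups (Fin.snoc P s : Fin (m + 1) → Bool) = ups P + if s = true then 1 else 0 := by
  unfold ups
  simp only [Finset.card_filter, Fin.sum_univ_castSucc, Fin.snoc_castSucc, Fin.snoc_last]

theorem endsDown_snoc {m : ℕ} (P : Fin m → Bool) (s : Bool) :
    EndsDown (Fin.snoc P s : Fin (m + 1) → Bool) ↔ s = false := by
  constructor
  · rintro ⟨i, hi, h⟩
    obtain rfl : i = Fin.last m := Fin.ext (by simpa using hi)
    simpa using h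
  · intro h
    exact ⟨Fin.last m, by simp, by simpa using h⟩

theorem isBallot_snoc {m : ℕ} (P : Fin m → Bool) (s : Bool) :
    IsBallot (Fin.snoc P s : Fin (m + 1) → Bool) ↔
      IsBallot P ∧ m + 1 ≤ 2 * ups (Fin.snoc P s : Fin (m + 1) → Bool) := by
  have h := card_filter_false_add_ups (Fin.snoc P s : Fin (m + 1) → Bool)
  have hl : ∀ b : Bool, (Finset.univ.filter fun i : Fin (m + 1) =>
      i ≤ Fin.last m ∧ (Fin.snoc P s : Fin (m + 1) → Bool) i = b) =
      Finset.univ.filter fun i => (Fin.snoc P s : Fin (m + 1) → Bool) i = b := by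
    intro b
    simp [Fin.le_last]
  have hc : ∀ (j : Fin m) (b : Bool), (Finset.univ.filter fun i : Fin (m + 1) =>
      i ≤ j.castSucc ∧ (Fin.snoc P s : Fin (m + 1) → Bool) i = b).card =
      (Finset.univ.filter fun i => i ≤ j ∧ P i = b).card := by
    intro j b
    simp only [Finset.card_filter, Fin.sum_univ_castSucc, Fin.castSucc_le_castSucc_iff,
      Fin.snoc_castSucc, Fin.last_le_iff, (Fin.castSucc_lt_last j).ne, false_and, if_false, add_zero]
  unfold IsBallot
  rw [Fin.forall_fin_succ']
  simp only [hl, hc]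
  refine and_congr_right fun _ => ?_
  change _ ≤ ups _ ↔ _
  omega

theorem isBallot_le {m : ℕ} {P : Fin m → Bool} (h : IsBallot P) : m ≤ 2 * ups P := by
  cases m with
  | zero => simp
  | succ m =>
    rw [← Fin.snoc_init_self P] at h ⊢
    exact ((isBallot_snoc _ _).1 h).2

theorem valleys_snoc {m : ℕ} (P : Fin m → Bool) (s : Bool) :
    valleys (Fin.snoc P s : Fin (m + 1) → Bool) =
      valleys P + if s = true ∧ EndsDown P then 1 else 0 := by
  unfold valleys
  rw [Finset.card_filter, Finset.card_filter, Fin.sum_univ_castSucc]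
  simp only [Fin.val_castSucc, Fin.val_last, lt_irrefl, dite_false, Bool.false_eq_true, if_false,
    add_zero]
  cases m with
  | zero => simp [EndsDown]
  | succ m =>
    induction P using Fin.snocCases with
    | snoc P t =>
    rw [Fin.sum_univ_castSucc, Fin.sum_univ_castSucc (n := m)]
    simp only [endsDown_snoc]
    have h1 : ∀ i : Fin m, (Fin.snoc (Fin.snoc P t : Fin (m + 1) → Bool) s : Fin (m + 2) → Bool)
        ⟨(i : ℕ) + 1, by omega⟩ = (Fin.snoc P t : Fin (m + 1) → Bool) ⟨(i : ℕ) + 1, by omega⟩ :=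
      fun i => Fin.snoc_castSucc (α := fun _ => Bool) (n := m + 1) s _ ⟨(i : ℕ) + 1, by omega⟩
    have h2 : (Fin.snoc (Fin.snoc P t : Fin (m + 1) → Bool) s : Fin (m + 2) → Bool)
        ⟨m + 1, by omega⟩ = s := Fin.snoc_last (α := fun _ => Bool) (n := m + 1) s _
    simp only [Fin.snoc_castSucc, Fin.snoc_last, Fin.val_castSucc, Fin.val_last, h1, h2]
    cases s <;> cases t <;> simp

/-- The number of ballot sequences with `a` up steps and `v` valleys, not ending in a down step. -/
noncomputable def countUp (m a v : ℕ) : ℤ :=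
  ∑ P : Fin m → Bool, if IsBallot P ∧ ups P = a ∧ valleys P = v ∧ ¬ EndsDown P then 1 else 0

/-- The number of ballot sequences with `a` up steps and `v` valleys, ending in a down step. -/
noncomputable def countDown (m a v : ℕ) : ℤ :=
  ∑ P : Fin m → Bool, if IsBallot P ∧ ups P = a ∧ valleys P = v ∧ EndsDown P then 1 else 0

theorem sum_snoc {m : ℕ} (f : (Fin (m + 1) → Bool) → ℤ) :
    ∑ P, f P =
      ∑ P : Fin m → Bool, f (Fin.snoc P true) + ∑ P : Fin m → Bool, f (Fin.snoc P false) := by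
  rw [← (Fin.snocEquiv (fun _ : Fin (m + 1) => Bool)).sum_comp, Fintype.sum_prod_type,
    Fintype.sum_bool]
  rfl

theorem countDown_succ {m a : ℕ} (v : ℕ) (h : m + 1 ≤ 2 * a) :
    countDown (m + 1) a v = countUp m a v + countDown m a v := by
  unfold countDown countUp
  rw [sum_snoc]
  simp only [← Finset.sum_add_distrib, endsDown_snoc, isBallot_snoc, ups_snoc, valleys_snoc]
  refine Finset.sum_congr rfl fun P _ => ?_
  by_cases h1 : IsBallot P <;> by_cases h2 : EndsDown P <;> by_cases h3 : ups P = a <;>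
    simp [h1, h2, h3, h]

theorem countUp_succ_succ {m a : ℕ} (v : ℕ) (h : m + 1 ≤ 2 * (a + 1)) :
    countUp (m + 1) (a + 1) (v + 1) = countUp m a (v + 1) + countDown m a v := by
  unfold countDown countUp
  rw [sum_snoc]
  simp only [← Finset.sum_add_distrib, endsDown_snoc, isBallot_snoc, ups_snoc, valleys_snoc]
  refine Finset.sum_congr rfl fun P _ => ?_
  by_cases h1 : IsBallot P <;> by_cases h2 : EndsDown P <;> by_cases h3 : ups P = a <;>
    simp [h1, h2, h3, h]

theorem countUp_succ_zero {m a : ℕ} (h : m + 1 ≤ 2 * (a + 1)) :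
    countUp (m + 1) (a + 1) 0 = countUp m a 0 := by
  unfold countUp
  rw [sum_snoc]
  simp only [← Finset.sum_add_distrib, endsDown_snoc, isBallot_snoc, ups_snoc, valleys_snoc]
  refine Finset.sum_congr rfl fun P _ => ?_
  by_cases h1 : IsBallot P <;> by_cases h2 : EndsDown P <;> by_cases h3 : ups P = a <;>
    simp [h1, h2, h3, h]

theorem count_eq_zero {m a : ℕ} (v : ℕ) (h : 2 * a < m) :
    countUp m a v = 0 ∧ countDown m a v = 0 := by
  unfold countDown countUp
  constructor <;>
  · refine Finset.sum_eq_zero fun P _ => if_neg ?_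
    rintro ⟨h1, h2, -⟩
    have := isBallot_le h1
    omega

theorem count_zero (a v : ℕ) :
    countUp 0 a v = (if a = 0 ∧ v = 0 then 1 else 0) ∧ countDown 0 a v = 0 := by
  simp [countUp, countDown, IsBallot, ups, valleys, EndsDown, @eq_comm ℕ 0]

theorem countDown_self (m v : ℕ) : countDown m m v = 0 := by
  refine Finset.sum_eq_zero fun P _ => if_neg ?_
  rintro ⟨-, h2, -, i, -, h⟩
  have := card_filter_false_add_ups P
  have hi : (Finset.univ.filter fun i => P i = false).card ≠ 0 :=
    Finset.card_ne_zero_of_mem (a := i) (by simpa using h)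
  omega

/-- Closed form of `countUp (a + b) a v`. -/
def upForm : ℕ → ℕ → ℕ → ℤ
  | _, 0, 0 => 1
  | _, 0, _ + 1 => 0
  | 0, _ + 1, _ => 0
  | _ + 1, _ + 1, 0 => 0
  | a + 1, b + 1, v + 1 => a.choose (v + 1) * b.choose v - a.choose v * b.choose (v + 1)

/-- Closed form of `countDown (a + b) a v`. -/
def downForm : ℕ → ℕ → ℕ → ℤ
  | _, 0, _ => 0
  | 0, _ + 1, _ => 0
  | _ + 1, _ + 1, 0 => 1
  | a + 1, b + 1, v + 1 =>
    a.choose (v + 1) * b.choose (v + 1) - a.choose v * b.choose (v + 2)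

theorem downForm_succ {a b : ℕ} (v : ℕ) (h : b < a) :
    downForm a (b + 1) v = upForm a b v + downForm a b v := by
  obtain ⟨a, rfl⟩ := Nat.exists_eq_succ_of_ne_zero (by omega : a ≠ 0)
  rcases b with _ | b <;> rcases v with _ | v <;> simp [downForm, upForm, Nat.choose_succ_succ]
  ring

theorem upForm_succ_succ {a b : ℕ} (v : ℕ) (h : b ≤ a) :
    upForm (a + 1) b (v + 1) = upForm a b (v + 1) + downForm a b v := by
  rcases a with _ | a <;> rcases b with _ | b <;> rcases v with _ | v <;>
    simp [downForm, upForm, Nat.choose_succ_succ'] at h ⊢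
  all_goals ring

theorem upForm_succ_zero {a b : ℕ} (h : b ≤ a) :
    upForm (a + 1) b 0 = upForm a b 0 := by
  rcases a with _ | a <;> rcases b with _ | b <;> simp [upForm] at h ⊢

theorem upForm_succ_self (a v : ℕ) : upForm (a + 1) (a + 1) v = 0 := by
  rcases v with _ | v <;> simp [upForm]
  ring

theorem count_eq_form (a b v : ℕ) (h : b ≤ a) :
    countUp (a + b) a v = upForm a b v ∧ countDown (a + b) a v = downForm a b v := by
  induction hm : a + b generalizing a b v with
  | zero =>
    obtain ⟨rfl, rfl⟩ : a = 0 ∧ b = 0 := by omega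
    rcases v with _ | v <;> simp [count_zero, upForm, downForm]
  | succ m ih =>
    constructor
    · obtain ⟨a, rfl⟩ := Nat.exists_eq_succ_of_ne_zero (by omega : a ≠ 0)
      rcases Nat.lt_or_eq_of_le h with h' | rfl
      · rcases v with _ | v
        · rw [countUp_succ_zero (by omega), upForm_succ_zero (by omega),
            (ih a b 0 (by omega) (by omega)).1]
        · rw [countUp_succ_succ v (by omega), upForm_succ_succ v (by omega),
            (ih a b _ (by omega) (by omega)).1, (ih a b _ (by omega) (by omega)).2]
      · rw [upForm_succ_self]
        rcases v with _ | v
        · rw [countUp_succ_zero (by omega), (count_eq_zero _ (by omega)).1]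
        · rw [countUp_succ_succ v (by omega), (count_eq_zero _ (by omega)).1,
            (count_eq_zero _ (by omega)).2, add_zero]
    · rcases b with _ | b
      · obtain rfl : a = m + 1 := by omega
        rw [countDown_self]
        simp [downForm]
      · rw [countDown_succ v (by omega), downForm_succ v (by omega),
          (ih a b v (by omega) (by omega)).1, (ih a b v (by omega) (by omega)).2]

theorem downForm_self (m v : ℕ) :
    (m + 1 : ℤ) * downForm (m + 1) (m + 1) v = (m + 1).choose (v + 1) * (m + 1).choose v := by
  rcases v with _ | v
  · simp [downForm]
  · have h1 := Nat.add_one_mul_choose_eq m v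
    have h2 := Nat.add_one_mul_choose_eq m (v + 1)
    have h3 := Nat.choose_succ_succ' m v
    have h4 := Nat.choose_succ_succ' m (v + 1)
    rw [h3] at h1 ⊢
    rw [h4] at h2 ⊢
    zify at h1 h2
    push_cast [downForm] at h1 h2 ⊢
    linear_combination (m.choose (v + 1) : ℤ) * h2 - m.choose (v + 2) * h1
      + (m.choose v * h2 - m.choose (v + 1) * h1)

theorem valleys_le_ups {m : ℕ} (P : Fin m → Bool) : valleys P ≤ ups P := by
  induction m with
  | zero => simp [valleys]
  | succ m ih =>
    rw [← Fin.snoc_init_self P, valleys_snoc, ups_snoc]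
    have := ih (Fin.init P)
    split_ifs <;> first | omega | simp_all

theorem valleys_le {m : ℕ} {P : Fin (2 * m) → Bool} (h : IsDyck P) : valleys P ≤ m := by
  have h1 := valleys_le_ups P
  have h2 : 2 * ups P = 2 * m := h.1
  omega

theorem sum_dyck (m : ℕ) (f : ℕ → ℝ) :
    ∑ P ∈ Finset.univ.filter (fun P : Fin (2 * (m + 1)) → Bool => IsDyck P), f (valleys P) =
      ∑ v ∈ Finset.range (m + 2), (downForm (m + 1) (m + 1) v : ℝ) * f v := by
  have hmaps : ∀ P ∈ Finset.univ.filter (fun P : Fin (2 * (m + 1)) → Bool => IsDyck P),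
      valleys P ∈ Finset.range (m + 2) := by
    intro P hP
    have := valleys_le (by simpa using hP)
    simp; omega
  rw [← Finset.sum_fiberwise_of_maps_to hmaps]
  refine Finset.sum_congr rfl fun v _ => ?_
  have hc := count_eq_form (m + 1) (m + 1) v le_rfl
  rw [upForm_succ_self, ← two_mul] at hc
  have : downForm (m + 1) (m + 1) v =
      (((Finset.univ.filter (fun P : Fin (2 * (m + 1)) → Bool => IsDyck P)).filter
        fun P => valleys P = v).card : ℤ) := by
    rw [← hc.2, ← zero_add (countDown _ _ _), ← hc.1, countUp, countDown,
      ← Finset.sum_add_distrib, Finset.filter_filter, Finset.card_filter]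
    push_cast
    refine Finset.sum_congr rfl fun P _ => ?_
    have hd : IsDyck P ↔ IsBallot P ∧ ups P = m + 1 := by
      unfold IsDyck IsBallot ups
      rw [and_comm]
      refine and_congr_right fun _ => ?_
      omega
    rw [hd]
    by_cases h1 : IsBallot P <;> by_cases h2 : EndsDown P <;> by_cases h3 : ups P = m + 1 <;>
      simp [h1, h2, h3]
  rw [this, Finset.sum_congr rfl (g := fun _ => f v), Finset.sum_const, nsmul_eq_mul]
  · simp
  · intro P hP
    rw [(Finset.mem_filter.1 hP).2]

theorem sum_choose_mul (m j : ℕ) (h : j ≤ m) :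
    ∑ v ∈ Finset.range (m + 1), m.choose (v + 1) * m.choose v * v.choose j =
      m.choose j * (2 * m - j).choose (m + 1) := by
  rw [show 2 * m - j = m + (m - j) by omega, Nat.add_choose_eq,
    Finset.Nat.sum_antidiagonal_eq_sum_range_succ (fun a b => m.choose a * (m - j).choose b),
    Finset.sum_range_succ' _ (m + 1), tsub_zero,
    Nat.choose_eq_zero_of_lt (show m - j < m + 1 by omega), mul_zero, add_zero, Finset.mul_sum]
  refine Finset.sum_congr rfl fun v hv => ?_
  have hv : v ≤ m := by simpa [Nat.lt_succ_iff] using hv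
  rw [show m + 1 - (v + 1) = m - v by omega]
  rcases lt_or_ge v j with hj | hj
  · rw [Nat.choose_eq_zero_of_lt hj, Nat.choose_eq_zero_of_lt (n := m - j) (by omega)]
    simp
  · rw [mul_assoc, Nat.choose_mul hj,
      Nat.choose_symm_of_eq_add (show m - j = (v - j) + (m - v) by omega)]
    ring

theorem pow_mul_add_one_pow (d : ℝ) {m v : ℕ} (h : v ≤ m) :
    d ^ (m - v) * (d + 1) ^ v = ∑ j ∈ Finset.range (m + 1), (v.choose j : ℝ) * d ^ (m - j) := by
  have hsub : Finset.range (v + 1) ⊆ Finset.range (m + 1) := Finset.range_mono (by omega)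
  rw [← Finset.sum_subset hsub, add_comm d 1, add_pow, Finset.mul_sum]
  · refine Finset.sum_congr rfl fun j hj => ?_
    have hj : j ≤ v := by simpa [Nat.lt_succ_iff] using hj
    rw [show m - j = (m - v) + (v - j) by omega, pow_add]
    ring
  · intro j _ hj
    rw [Nat.choose_eq_zero_of_lt (by simpa using hj)]
    simp

theorem sum_choose_mul_pow (d : ℝ) (m : ℕ) :
    ∑ v ∈ Finset.range (m + 1),
        (m.choose (v + 1) * m.choose v : ℝ) * (d ^ (m - v) * (d + 1) ^ v) =
      ∑ k ∈ Finset.range (m + 1), (m.choose k * (m + k).choose (m + 1) : ℝ) * d ^ k := by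
  rw [← Finset.sum_range_reflect (fun k => (m.choose k * (m + k).choose (m + 1) : ℝ) * d ^ k)]
  calc
    _ = ∑ v ∈ Finset.range (m + 1), ∑ j ∈ Finset.range (m + 1),
          (m.choose (v + 1) * m.choose v * v.choose j : ℝ) * d ^ (m - j) := by
      refine Finset.sum_congr rfl fun v hv => ?_
      rw [pow_mul_add_one_pow d (by simpa [Nat.lt_succ_iff] using hv), Finset.mul_sum]
      exact Finset.sum_congr rfl fun j _ => by ring
    _ = _ := by
      rw [Finset.sum_comm]
      refine Finset.sum_congr rfl fun j hj => ?_
      have hj : j ≤ m := by simpa [Nat.lt_succ_iff] using hj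
      rw [← Finset.sum_mul, show m + 1 - 1 - j = m - j by omega, Nat.choose_symm hj,
        show m + (m - j) = 2 * m - j by omega]
      congr 1
      exact_mod_cast sum_choose_mul m j hj

/-- `s_d(n) = Σ_{P ∈ D_n} d^{U_V(P)}·(d+1)^{V(P)}`, where `U_V(P) = (n−1) − V(P)`. -/
theorem weighted_schroeder_eq_valley_sum (d : ℝ) (n : ℕ) (hn : 1 ≤ n) :
    sd d n
      = ∑ P ∈ Finset.univ.filter (fun P : Fin (2 * (n - 1)) → Bool => IsDyck P),
          d ^ ((n - 1) - valleys P) * (d + 1) ^ valleys P := by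
  obtain ⟨m, rfl⟩ := Nat.exists_eq_add_of_le' hn
  rcases m with _ | m
  · simp [sd, schroederS, IsDyck, valleys]
  · have hm : (m + 1 : ℝ) ≠ 0 := by positivity
    refine Eq.trans ?_ (sum_dyck m fun v => d ^ (m + 1 - v) * (d + 1) ^ v).symm
    apply mul_left_cancel₀ hm
    have h := sum_choose_mul_pow d (m + 1)
    rw [sd, Finset.mul_sum, Finset.mul_sum]
    calc
      _ = _ := Finset.sum_congr rfl fun k _ => ?_
      _ = _ := h.symm
      _ = _ := Finset.sum_congr rfl fun v _ => ?_
    · rw [schroederS, if_neg (by omega)]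
      rw [show m + 1 + 1 + k - 1 = m + 1 + k by omega, Nat.add_sub_cancel]
      push_cast
      field_simp
      ring
    · rw [← mul_assoc (m + 1 : ℝ)]
      congr 1
      exact_mod_cast (downForm_self m v).symm
end

section
/- For every integer n ≥ 1 and all real numbers a, b with a ≠ b, Σ_{P ∈ D_n} a^{U_V(P)}·b^{V(P)} = (b−a)^{n−1}·s_{a/(b−a)}(n). -/
open scoped Classical

open Finset in
theorem Fin.card_filter_univ_castSucc {m : ℕ} (p : Fin (m + 1) → Prop) [DecidablePred p] :
    #{i | p i} = #{i : Fin m | p i.castSucc} + if p (Fin.last m) then 1 else 0 := by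
  simp only [card_filter, Fin.sum_univ_castSucc]

open Finset in
theorem Fin.card_filter_snoc {m : ℕ} (p : (Fin (m + 1) → Bool) → Prop)
    [DecidablePred p] :
    #{P | p P} = #{Q : Fin m → Bool | p (Fin.snoc Q true)}
      + #{Q : Fin m → Bool | p (Fin.snoc Q false)} := by
  simp only [card_filter]
  rw [← (Fin.snocEquiv fun _ : Fin (m + 1) => Bool).sum_comp, Fintype.sum_prod_type,
    Fintype.sum_bool]
  rfl

namespace BallotPath

/-- The number of up steps. -/
noncomputable def ups {m : ℕ} (P : Fin m → Bool) : ℕ :=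
  (Finset.univ.filter fun i => P i = true).card

/-- Every prefix has at least as many up steps as down steps. -/
def IsBallot {m : ℕ} (P : Fin m → Bool) : Prop :=
  ∀ j : Fin m,
    (Finset.univ.filter fun i => i ≤ j ∧ P i = false).card ≤
      (Finset.univ.filter fun i => i ≤ j ∧ P i = true).card

/-- The last step exists and is a down step. -/
def EndsDown {m : ℕ} (P : Fin m → Bool) : Prop :=
  ∃ i : Fin m, (i : ℕ) + 1 = m ∧ P i = false

theorem card_downs_add_ups {m : ℕ} (P : Fin m → Bool) :
    (Finset.univ.filter fun i => P i = false).card + ups P = m := by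
  have h := Finset.card_filter_add_card_filter_not (s := (Finset.univ : Finset (Fin m)))
    (fun i => P i = false)
  simpa [ups] using h

theorem ups_snoc {m : ℕ} (Q : Fin m → Bool) (c : Bool) :
    ups (Fin.snoc Q c : Fin (m + 1) → Bool) = ups Q + if c then 1 else 0 := by
  simp [ups, Fin.card_filter_univ_castSucc]

theorem endsDown_snoc {m : ℕ} (Q : Fin m → Bool) (c : Bool) :
    EndsDown (Fin.snoc Q c : Fin (m + 1) → Bool) ↔ c = false := by
  constructor
  · rintro ⟨i, hi, h⟩
    obtain rfl : i = Fin.last m := Fin.ext (by simpa using hi)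
    simpa using h
  · intro h
    exact ⟨Fin.last m, by simp, by simpa using h⟩

theorem valleys_snoc {m : ℕ} (Q : Fin m → Bool) (c : Bool) :
    valleys (Fin.snoc Q c : Fin (m + 1) → Bool)
      = valleys Q + if c = true ∧ EndsDown Q then 1 else 0 := by
  unfold valleys
  rw [Fin.card_filter_univ_castSucc]
  cases m with
  | zero => simp [EndsDown]
  | succ m =>
    rw [Fin.card_filter_univ_castSucc, Fin.card_filter_univ_castSucc (m := m)]
    have hends : EndsDown Q ↔ Q (Fin.last m) = false := by
      rw [← endsDown_snoc (Fin.init Q) (Q (Fin.last m)), Fin.snoc_init_self]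
    have hlast : (Fin.snoc Q c : Fin (m + 2) → Bool) ⟨m + 1, by omega⟩ = c :=
      Fin.snoc_last (α := fun _ => Bool) c Q
    have hcast : ∀ i : Fin m, (Fin.snoc Q c : Fin (m + 2) → Bool) ⟨i + 1, by omega⟩
        = Q ⟨i + 1, by omega⟩ := fun i =>
      Fin.snoc_castSucc (α := fun _ => Bool) c Q ⟨i + 1, by omega⟩
    simp [hends, hlast, hcast, and_comm]

theorem isBallot_snoc {m : ℕ} (Q : Fin m → Bool) (c : Bool) :
    IsBallot (Fin.snoc Q c : Fin (m + 1) → Bool)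
      ↔ IsBallot Q ∧ m + 1 ≤ 2 * ups (Fin.snoc Q c : Fin (m + 1) → Bool) := by
  have hc := card_downs_add_ups (Fin.snoc Q c : Fin (m + 1) → Bool)
  unfold IsBallot
  rw [Fin.forall_fin_succ']
  refine and_congr ?_ ?_
  · simp [Fin.card_filter_univ_castSucc]
  · simp only [Fin.le_last, true_and]
    unfold ups at *
    omega

theorem IsBallot.le_two_mul_ups {m : ℕ} {P : Fin m → Bool} (h : IsBallot P) :
    m ≤ 2 * ups P := by
  cases m with
  | zero => simp
  | succ m =>
    rw [← Fin.snoc_init_self P, isBallot_snoc] at h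
    simpa using h.2

open Finset in
/-- The number of ballot paths with `m` steps, `u` up steps and `v` valleys that end with a
down step (`e = true`) or do not (`e = false`). -/
noncomputable def pathCount (m u v : ℕ) (e : Bool) : ℕ :=
  #{P : Fin m → Bool | IsBallot P ∧ ups P = u ∧ valleys P = v ∧ (EndsDown P ↔ e = true)}

theorem pathCount_eq_zero {m u v : ℕ} {e : Bool} (h : 2 * u < m ∨ m < u) :
    pathCount m u v e = 0 := by
  simp only [pathCount, Finset.card_eq_zero, Finset.filter_eq_empty_iff]
  rintro P - ⟨hb, hu, -⟩
  have := hb.le_two_mul_ups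
  have := card_downs_add_ups P
  omega

theorem pathCount_zero (u v : ℕ) (e : Bool) :
    pathCount 0 u v e = if u = 0 ∧ v = 0 ∧ e = false then 1 else 0 := by
  have hP : ∀ P : Fin 0 → Bool, IsBallot P ∧ ups P = 0 ∧ valleys P = 0 ∧ ¬ EndsDown P := by
    simp [IsBallot, ups, valleys, EndsDown]
  unfold pathCount
  rw [Finset.card_filter, Fintype.sum_subsingleton _ Fin.elim0]
  obtain ⟨hb, hu, hv, he⟩ := hP Fin.elim0
  refine if_congr ?_ rfl rfl
  rw [hu, hv, eq_comm (a := 0), eq_comm (a := 0)]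
  cases e <;> simp [hb, he]

theorem isBallot_snoc_true {m : ℕ} (Q : Fin m → Bool) :
    IsBallot (Fin.snoc Q true : Fin (m + 1) → Bool) ↔ IsBallot Q := by
  rw [isBallot_snoc, ups_snoc, and_iff_left_iff_imp]
  intro h
  have := h.le_two_mul_ups
  simp
  omega

theorem pathCount_succ_true {m u v : ℕ} (h : m + 1 ≤ 2 * u) :
    pathCount (m + 1) u v true = pathCount m u v false + pathCount m u v true := by
  unfold pathCount
  rw [Fin.card_filter_snoc]
  simp only [isBallot_snoc, ups_snoc, valleys_snoc, endsDown_snoc]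
  simp only [Finset.card_filter, ← Finset.sum_add_distrib]
  refine Finset.sum_congr rfl fun Q _ => ?_
  by_cases hE : EndsDown Q <;> by_cases hu : ups Q = u <;> simp [hE, hu, h]

theorem pathCount_succ_false_zero (m u : ℕ) :
    pathCount (m + 1) (u + 1) 0 false = pathCount m u 0 false := by
  unfold pathCount
  rw [Fin.card_filter_snoc]
  simp only [isBallot_snoc_true, ups_snoc, valleys_snoc, endsDown_snoc]
  simp only [Finset.card_filter, ← Finset.sum_add_distrib]
  refine Finset.sum_congr rfl fun Q _ => ?_
  by_cases hE : EndsDown Q <;> simp [hE]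

theorem pathCount_succ_false_succ (m u v : ℕ) :
    pathCount (m + 1) (u + 1) (v + 1) false
      = pathCount m u (v + 1) false + pathCount m u v true := by
  unfold pathCount
  rw [Fin.card_filter_snoc]
  simp only [isBallot_snoc_true, ups_snoc, valleys_snoc, endsDown_snoc]
  simp only [Finset.card_filter, ← Finset.sum_add_distrib]
  refine Finset.sum_congr rfl fun Q _ => ?_
  by_cases hE : EndsDown Q <;> simp [hE]

/-- Closed form for the number of ballot paths with `u` up steps, `d` down steps and `v` valleys
that do not end with a down step. -/
def upFormula : ℕ → ℕ → ℕ → ℤ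
  | _, 0, 0 => 1
  | _, 0, _ + 1 => 0
  | 0, _ + 1, _ => 0
  | _ + 1, _ + 1, 0 => 0
  | u + 1, d + 1, v + 1 => u.choose (v + 1) * d.choose v - d.choose (v + 1) * u.choose v

/-- Closed form for the number of ballot paths with `u` up steps, `d` down steps and `v` valleys
that end with a down step. -/
def downFormula : ℕ → ℕ → ℕ → ℤ
  | _, 0, _ => 0
  | 0, _ + 1, _ => 0
  | _ + 1, _ + 1, 0 => 1
  | u + 1, d + 1, v + 1 =>
    u.choose (v + 1) * d.choose (v + 1) - d.choose (v + 2) * u.choose v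

theorem upFormula_succ_zero (u d : ℕ) : upFormula (u + 1) d 0 = upFormula u d 0 := by
  cases d <;> cases u <;> simp [upFormula]

theorem upFormula_succ_succ {u d : ℕ} (v : ℕ) (h : d ≤ u) :
    upFormula (u + 1) d (v + 1) = upFormula u d (v + 1) + downFormula u d v := by
  cases d with
  | zero => simp [upFormula, downFormula]
  | succ d =>
    obtain ⟨u, rfl⟩ : ∃ w, u = w + 1 := ⟨u - 1, by omega⟩
    cases v <;> simp [upFormula, downFormula, Nat.choose_succ_succ' u] <;> ring

theorem upFormula_self (u v : ℕ) : upFormula (u + 1) (u + 1) v = 0 := by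
  cases v <;> simp [upFormula, mul_comm]

theorem downFormula_succ {u d : ℕ} (v : ℕ) (h : d + 1 ≤ u) :
    downFormula u (d + 1) v = upFormula u d v + downFormula u d v := by
  obtain ⟨u, rfl⟩ : ∃ w, u = w + 1 := ⟨u - 1, by omega⟩
  cases d <;> cases v <;>
    (simp [upFormula, downFormula, Nat.choose_succ_succ']; try ring)

theorem pathCount_eq_formula (m : ℕ) : ∀ u d v : ℕ, u + d = m → d ≤ u →
    (pathCount m u v false : ℤ) = upFormula u d v ∧
      (pathCount m u v true : ℤ) = downFormula u d v := by
  induction m with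
  | zero =>
    intro u d v h _
    obtain ⟨rfl, rfl⟩ : u = 0 ∧ d = 0 := by omega
    cases v <;> simp [pathCount_zero, upFormula, downFormula]
  | succ m ih =>
    intro u d v h hd
    constructor
    · obtain ⟨u, rfl⟩ : ∃ w, u = w + 1 := ⟨u - 1, by omega⟩
      rcases hd.lt_or_eq with hlt | rfl
      · have hdu : d ≤ u := by omega
        cases v with
        | zero =>
          rw [pathCount_succ_false_zero, upFormula_succ_zero, (ih u d 0 (by omega) hdu).1]
        | succ v =>
          rw [pathCount_succ_false_succ, upFormula_succ_succ v hdu, Nat.cast_add,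
            (ih u d (v + 1) (by omega) hdu).1, (ih u d v (by omega) hdu).2]
      · rw [upFormula_self]
        cases v with
        | zero => rw [pathCount_succ_false_zero, pathCount_eq_zero (by omega), Nat.cast_zero]
        | succ v =>
          rw [pathCount_succ_false_succ, pathCount_eq_zero (by omega),
            pathCount_eq_zero (by omega), Nat.cast_zero]
    · rw [pathCount_succ_true (by omega), Nat.cast_add]
      cases d with
      | zero =>
        rw [pathCount_eq_zero (by omega), pathCount_eq_zero (by omega)]
        simp [downFormula]
      | succ d =>
        rw [downFormula_succ v hd, (ih u d v (by omega) (by omega)).1,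
          (ih u d v (by omega) (by omega)).2]

theorem downFormula_self (M v : ℕ) :
    ((M : ℤ) + 1) * downFormula (M + 1) (M + 1) v
      = (M + 1).choose v * (M + 1).choose (v + 1) := by
  cases v with
  | zero => simp [downFormula]
  | succ v =>
    rcases le_or_gt M v with hv | hv
    · simp [downFormula, Nat.choose_eq_zero_of_lt (show M < v + 1 by omega),
        Nat.choose_eq_zero_of_lt (show M < v + 2 by omega),
        Nat.choose_eq_zero_of_lt (show M + 1 < v + 2 by omega)]
    · obtain ⟨r, rfl⟩ := Nat.exists_eq_add_of_lt hv
      have h₁ := Nat.choose_succ_right_eq (v + r + 1) v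
      have h₂ := Nat.choose_succ_right_eq (v + r + 1) (v + 1)
      rw [show v + r + 1 - v = r + 1 by omega] at h₁
      rw [show v + r + 1 - (v + 1) = r by omega] at h₂
      simp only [downFormula, Nat.choose_succ_succ' (v + r + 1)]
      generalize (v + r + 1).choose v = x at *
      generalize (v + r + 1).choose (v + 1) = y at *
      generalize (v + r + 1).choose (v + 1 + 1) = z at *
      zify at h₁ h₂
      push_cast
      linear_combination ((y : ℤ) + z) * h₁ - ((y : ℤ) + x) * h₂

open Finset in
theorem card_isDyck_valleys (M v : ℕ) :
    (#{P : Fin (2 * (M + 1)) → Bool | IsDyck P ∧ valleys P = v} : ℤ)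
      = downFormula (M + 1) (M + 1) v := by
  obtain ⟨hU, hD⟩ := pathCount_eq_formula (2 * (M + 1)) (M + 1) (M + 1) v (by ring) le_rfl
  rw [← zero_add (downFormula _ _ _), ← upFormula_self M v, ← hU, ← hD]
  norm_cast
  unfold pathCount
  simp only [card_filter, ← sum_add_distrib]
  refine sum_congr rfl fun P _ => ?_
  have hP : IsDyck P ↔ IsBallot P ∧ ups P = M + 1 := by
    unfold IsDyck IsBallot ups
    rw [and_comm, Nat.mul_right_inj two_ne_zero]
  by_cases hE : EndsDown P <;> simp [hE, hP, and_assoc]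

theorem downFormula_self_eq_zero {M v : ℕ} (h : M + 1 ≤ v) :
    downFormula (M + 1) (M + 1) v = 0 := by
  obtain ⟨v, rfl⟩ : ∃ w, v = w + 1 := ⟨v - 1, by omega⟩
  simp [downFormula, Nat.choose_eq_zero_of_lt (show M < v + 1 by omega),
    Nat.choose_eq_zero_of_lt (show M < v + 2 by omega)]

theorem valleys_le {m : ℕ} (P : Fin m → Bool) : valleys P ≤ m := by
  unfold valleys
  exact (Finset.card_filter_le _ _).trans (by simp)

open Finset in
theorem sum_isDyck_valleys (M : ℕ) (f : ℕ → ℝ) :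
    ∑ P : Fin (2 * (M + 1)) → Bool with IsDyck P, f (valleys P)
      = ∑ v ∈ range (M + 2), (downFormula (M + 1) (M + 1) v : ℝ) * f v := by
  have hmaps : ∀ P ∈ ({P | IsDyck P} : Finset (Fin (2 * (M + 1)) → Bool)),
      valleys P ∈ range (2 * (M + 1) + 1) := fun P _ =>
    mem_range.2 (Nat.lt_succ_of_le (valleys_le P))
  rw [← sum_fiberwise_of_maps_to hmaps,
    sum_subset (range_mono (show M + 2 ≤ 2 * (M + 1) + 1 by omega))]
  · refine sum_congr rfl fun v _ => ?_
    rw [sum_congr rfl fun P hP => by rw [(mem_filter.1 hP).2], sum_const, nsmul_eq_mul,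
      filter_filter, ← card_isDyck_valleys, Int.cast_natCast]
  · intro v _ hv
    rw [downFormula_self_eq_zero (by simp at hv; omega), Int.cast_zero, zero_mul]

end BallotPath

theorem Nat.choose_mul_choose_eq_choose_mul_choose_sub {N v j : ℕ} (hv : v ≤ N) (hj : j ≤ N) :
    N.choose v * v.choose j = N.choose j * (N - j).choose (N - v) := by
  rcases le_or_gt j v with h | h
  · rw [Nat.choose_mul h, Nat.choose_symm_of_eq_add (show N - j = (v - j) + (N - v) by omega)]
  · rw [Nat.choose_eq_zero_of_lt h, Nat.choose_eq_zero_of_lt (show N - j < N - v by omega),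
      mul_zero, mul_zero]

open Finset in
theorem Nat.sum_choose_mul_choose_succ_mul_choose {N j : ℕ} (hj : j ≤ N) :
    ∑ v ∈ range (N + 1), N.choose v * N.choose (v + 1) * v.choose j
      = N.choose j * (N + (N - j)).choose (N + 1) := by
  rw [Nat.add_choose_eq,
    Finset.Nat.sum_antidiagonal_eq_sum_range_succ fun l i => N.choose l * (N - j).choose i,
    sum_range_succ' _ (N + 1), Nat.choose_eq_zero_of_lt (show N - j < N + 1 - 0 by omega), mul_zero,
    add_zero, mul_sum]
  refine sum_congr rfl fun v hv => ?_
  rw [mul_right_comm,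
    Nat.choose_mul_choose_eq_choose_mul_choose_sub (mem_range_succ_iff.1 hv) hj,
    Nat.add_sub_add_right]
  ring

open Finset BallotPath in
theorem schroederS_eq_sum {M j : ℕ} (hj : j ≤ M + 1) :
    schroederS (M + 2) (M + 1 - j)
      = ∑ v ∈ range (M + 2), (downFormula (M + 1) (M + 1) v : ℝ) * v.choose j := by
  have hM : (M : ℝ) + 1 ≠ 0 := by positivity
  have hsum := congrArg (Nat.cast : ℕ → ℝ) (Nat.sum_choose_mul_choose_succ_mul_choose hj)
  push_cast at hsum
  have hS : schroederS (M + 2) (M + 1 - j)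
      = 1 / ((M : ℝ) + 1) * ((M + 1).choose j * (M + 1 + (M + 1 - j)).choose (M + 1 + 1)) := by
    unfold schroederS
    rw [if_neg (by omega), show M + 2 - 1 = M + 1 by omega, Nat.choose_symm hj,
      show M + 2 + (M + 1 - j) - 1 = M + 1 + (M + 1 - j) by omega]
    push_cast
    ring
  rw [hS, ← hsum, mul_sum]
  refine sum_congr rfl fun v _ => ?_
  have h := congrArg (Int.cast : ℤ → ℝ) (downFormula_self M v)
  push_cast at h
  rw [← h]
  field_simp

open Finset in
theorem pow_sub_mul_add_pow {R : Type*} [CommSemiring R] (a c : R) {N v : ℕ} (hv : v ≤ N) :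
    a ^ (N - v) * (c + a) ^ v
      = ∑ j ∈ range (N + 1), (v.choose j : R) * (c ^ j * a ^ (N - j)) := by
  rw [add_pow, mul_sum, sum_subset (range_mono (show v + 1 ≤ N + 1 by omega))]
  · refine sum_congr rfl fun j _ => ?_
    rcases le_or_gt j v with hj | hj
    · rw [show N - j = (N - v) + (v - j) by omega, pow_add]
      ring
    · simp [Nat.choose_eq_zero_of_lt hj]
  · intro j _ hj
    simp [Nat.choose_eq_zero_of_lt (show v < j by simpa using hj)]

theorem mul_sd_div (N : ℕ) (a : ℝ) {c : ℝ} (hc : c ≠ 0) :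
    c ^ N * sd (a / c) (N + 1)
      = ∑ j ∈ Finset.range (N + 1), schroederS (N + 1) (N - j) * (c ^ j * a ^ (N - j)) := by
  unfold sd
  rw [← Finset.sum_range_reflect, Finset.mul_sum]
  refine Finset.sum_congr rfl fun j hj => ?_
  have hj : j ≤ N := Finset.mem_range_succ_iff.1 hj
  rw [show N + 1 - 1 - j = N - j by omega, div_pow]
  nth_rewrite 1 [show N = j + (N - j) by omega]
  rw [pow_add]
  field_simp

/-- For `a ≠ b`: `Σ_{P ∈ D_n} a^{U_V(P)}·b^{V(P)} = (b−a)^{n−1}·s_{a/(b−a)}(n)`. -/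
theorem valley_sum_eq_weighted_schroeder (n : ℕ) (hn : 1 ≤ n) (a b : ℝ) (hab : a ≠ b) :
    ∑ P ∈ Finset.univ.filter (fun P : Fin (2 * (n - 1)) → Bool => IsDyck P),
        a ^ ((n - 1) - valleys P) * b ^ valleys P
      = (b - a) ^ (n - 1) * sd (a / (b - a)) n := by
  have hc : b - a ≠ 0 := sub_ne_zero.2 hab.symm
  obtain ⟨N, rfl⟩ : ∃ N, n = N + 1 := ⟨n - 1, by omega⟩
  rw [Nat.add_sub_cancel, mul_sd_div N a hc]
  cases N with
  | zero =>
    simp [schroederS, IsDyck, valleys]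
  | succ M =>
    rw [BallotPath.sum_isDyck_valleys M fun v => a ^ (M + 1 - v) * b ^ v]
    have hexp : ∀ v ∈ Finset.range (M + 2),
        (BallotPath.downFormula (M + 1) (M + 1) v : ℝ) * (a ^ (M + 1 - v) * b ^ v)
          = ∑ j ∈ Finset.range (M + 2), (BallotPath.downFormula (M + 1) (M + 1) v : ℝ)
              * (v.choose j * ((b - a) ^ j * a ^ (M + 1 - j))) := by
      intro v hv
      rw [← Finset.mul_sum, ← pow_sub_mul_add_pow a (b - a) (Finset.mem_range_succ_iff.1 hv),
        sub_add_cancel]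
    rw [Finset.sum_congr rfl hexp, Finset.sum_comm]
    refine Finset.sum_congr rfl fun j hj => ?_
    rw [schroederS_eq_sum (Finset.mem_range_succ_iff.1 hj), Finset.sum_mul]
    simp only [mul_assoc]
end

section
/- For all real numbers a, b and every integer n ≥ 1, Σ_{P ∈ D_n} a^{U_V(P)}·b^{V(P)} = Σ_{P ∈ D_n} a^{K(P)}·b^{U_K(P)}. -/
open scoped Classical

/-- The number of pairs of consecutive entries of a list that satisfy `r`. -/
def countAdj {α : Type*} (r : α → α → Bool) : List α → ℕ
  | [] => 0
  | [_] => 0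
  | x :: y :: l => (r x y).toNat + countAdj r (y :: l)

theorem countAdj_append_cons {α : Type*} (r : α → α → Bool) (l : List α) (x y : α) (l' : List α) :
    countAdj r (l ++ [x] ++ y :: l') =
      countAdj r (l ++ [x]) + (r x y).toNat + countAdj r (y :: l') := by
  induction l with
  | nil => simp [countAdj]
  | cons a l ih =>
    cases l with
    | nil => simp [countAdj]; ring
    | cons b l => simp only [List.cons_append, countAdj] at ih ⊢; rw [ih]; ring

theorem countAdj_map {α β : Type*} (r : β → β → Bool) (f : α → β) (l : List α) :
    countAdj r (l.map f) = countAdj (fun x y => r (f x) (f y)) l := by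
  induction l with
  | nil => rfl
  | cons a l ih =>
    cases l with
    | nil => rfl
    | cons b l => simp only [List.map_cons, countAdj] at ih ⊢; rw [ih]

theorem countAdj_ofFn {α : Type*} (r : α → α → Bool) :
    ∀ {m : ℕ} (P : Fin m → α), countAdj r (List.ofFn P) =
      (Finset.univ.filter fun i : Fin m =>
        (if h : (i : ℕ) + 1 < m then r (P i) (P ⟨(i : ℕ) + 1, h⟩) else false) = true).card
  | 0, P => by simp [countAdj]
  | 1, P => by simp [countAdj]
  | m + 2, P => by
    have ih := countAdj_ofFn r (fun i : Fin (m + 1) => P i.succ)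
    rw [List.ofFn_succ] at ih
    rw [List.ofFn_succ, List.ofFn_succ, countAdj, ih, Finset.card_filter, Finset.card_filter,
      Fin.sum_univ_succ (n := m + 1)]
    congr 1
    · cases h : r (P 0) (P (Fin.succ 0)) <;> simp_all
    · refine Finset.sum_congr rfl fun i _ => ?_
      simp

theorem count_take_ofFn {α : Type*} [DecidableEq α] (c : α) :
    ∀ {m : ℕ} (P : Fin m → α) (k : ℕ), ((List.ofFn P).take k).count c =
      (Finset.univ.filter fun i : Fin m => (i : ℕ) < k ∧ P i = c).card
  | 0, P, k => by simp
  | m + 1, P, 0 => by simp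
  | m + 1, P, k + 1 => by
    rw [List.ofFn_succ, List.take_succ_cons, List.count_cons, count_take_ofFn,
      Finset.card_filter, Finset.card_filter, Fin.sum_univ_succ, add_comm]
    simp

namespace DyckStep

/-- The step encoded by a Boolean: `true` is an up step and `false` a down step. -/
def ofBool (b : Bool) : DyckStep := if b = true then U else D

theorem ofBool_injective : Function.Injective ofBool := by
  intro a b; cases a <;> cases b <;> simp [ofBool]

/-- Whether two consecutive steps form a valley. -/
def isValley (x y : DyckStep) : Bool := x == D && y == U

/-- Whether two consecutive steps form a peak. -/
def isPeak (x y : DyckStep) : Bool := x == U && y == D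

end DyckStep

namespace DyckWord

open DyckStep

theorem toList_nest_add (p q : DyckWord) :
    (p.nest + q).toList = U :: (p.toList ++ D :: q.toList) := by
  change [U] ++ p.toList ++ [D] ++ q.toList = _
  simp

theorem eq_zero_or_nest_add (p : DyckWord) : p = 0 ∨ ∃ q r : DyckWord, p = q.nest + r := by
  by_cases h : p = 0
  · exact Or.inl h
  · exact Or.inr ⟨_, _, (nest_insidePart_add_outsidePart h).symm⟩

theorem exists_toList_eq_cons {p : DyckWord} (h : p ≠ 0) : ∃ l, p.toList = U :: l := by
  obtain rfl | ⟨q, r, rfl⟩ := p.eq_zero_or_nest_add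
  · exact absurd rfl h
  · exact ⟨_, toList_nest_add q r⟩

theorem exists_toList_eq_concat {p : DyckWord} (h : p ≠ 0) : ∃ l, p.toList = l ++ [D] :=
  ⟨_, (cons_tail_dropLast_concat h).symm⟩

/-- The number of valleys of a Dyck word. -/
def valleyCount (p : DyckWord) : ℕ := countAdj isValley p.toList

/-- The number of peaks of a Dyck word. -/
def peakCount (p : DyckWord) : ℕ := countAdj isPeak p.toList

@[simp] theorem valleyCount_zero : valleyCount 0 = 0 := rfl

@[simp] theorem peakCount_zero : peakCount 0 = 0 := rfl

theorem valleyCount_nest (p : DyckWord) : p.nest.valleyCount = p.valleyCount := by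
  change countAdj isValley (U :: p.toList ++ [D]) = countAdj isValley p.toList
  by_cases h : p = 0
  · subst h; rfl
  · obtain ⟨l, hl⟩ := exists_toList_eq_concat h
    obtain ⟨l', hl'⟩ := exists_toList_eq_cons h
    have h1 := countAdj_append_cons isValley (U :: l) D D []
    have h2 : countAdj isValley (U :: p.toList) = countAdj isValley p.toList := by
      rw [hl', countAdj]; simp [isValley]
    rw [← h2, hl]
    simpa [countAdj, isValley, show (D == U) = false from rfl] using h1

theorem peakCount_nest (p : DyckWord) :
    p.nest.peakCount = p.peakCount + if p = 0 then 1 else 0 := by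
  change countAdj isPeak (U :: p.toList ++ [D]) = countAdj isPeak p.toList + _
  by_cases h : p = 0
  · subst h; rfl
  · obtain ⟨l, hl⟩ := exists_toList_eq_concat h
    obtain ⟨l', hl'⟩ := exists_toList_eq_cons h
    have h1 := countAdj_append_cons isPeak (U :: l) D D []
    have h2 : countAdj isPeak (U :: p.toList) = countAdj isPeak p.toList := by
      rw [hl', countAdj]; simp [isPeak]
    rw [← h2, hl, if_neg h]
    simpa [countAdj, isPeak, show (D == U) = false from rfl] using h1

theorem valleyCount_add {p q : DyckWord} (hp : p ≠ 0) (hq : q ≠ 0) :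
    (p + q).valleyCount = p.valleyCount + 1 + q.valleyCount := by
  obtain ⟨l, hl⟩ := exists_toList_eq_concat hp
  obtain ⟨l', hl'⟩ := exists_toList_eq_cons hq
  change countAdj isValley (p.toList ++ q.toList) =
    countAdj isValley p.toList + 1 + countAdj isValley q.toList
  rw [hl, hl', countAdj_append_cons]
  rfl

theorem peakCount_add (p q : DyckWord) : (p + q).peakCount = p.peakCount + q.peakCount := by
  by_cases hp : p = 0
  · simp [hp]
  by_cases hq : q = 0
  · simp [hq]
  obtain ⟨l, hl⟩ := exists_toList_eq_concat hp
  obtain ⟨l', hl'⟩ := exists_toList_eq_cons hq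
  change countAdj isPeak (p.toList ++ q.toList) =
    countAdj isPeak p.toList + countAdj isPeak q.toList
  rw [hl, hl', countAdj_append_cons]
  rfl

theorem valleyCount_nest_add (p q : DyckWord) :
    (p.nest + q).valleyCount = p.valleyCount + q.valleyCount + if q = 0 then 0 else 1 := by
  by_cases hq : q = 0
  · simp [hq, valleyCount_nest]
  · rw [valleyCount_add nest_ne_zero hq, valleyCount_nest, if_neg hq]; ring

/-- Reverse the roles of inside and outside parts throughout the first-return decomposition;
on binary trees this is reflection. -/
def reflect (p : DyckWord) : DyckWord :=
  if p = 0 then 0 else p.outsidePart.reflect.nest + p.insidePart.reflect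
termination_by p.semilength
decreasing_by exacts [semilength_outsidePart_lt ‹_›, semilength_insidePart_lt ‹_›]

@[simp] theorem reflect_zero : reflect 0 = 0 := by rw [reflect, if_pos rfl]

theorem reflect_nest_add (p q : DyckWord) :
    (p.nest + q).reflect = q.reflect.nest + p.reflect := by
  rw [reflect, if_neg (by simp), insidePart_add nest_ne_zero, outsidePart_add nest_ne_zero]
  simp

theorem nest_add_induction {motive : DyckWord → Prop} (zero : motive 0)
    (nest_add : ∀ p q, motive p → motive q → motive (p.nest + q)) (p : DyckWord) : motive p := by
  by_cases h : p = 0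
  · exact h ▸ zero
  · rw [← nest_insidePart_add_outsidePart h]
    exact nest_add _ _ (nest_add_induction zero nest_add _) (nest_add_induction zero nest_add _)
termination_by p.semilength
decreasing_by exacts [semilength_insidePart_lt h, semilength_outsidePart_lt h]

theorem reflect_reflect (p : DyckWord) : p.reflect.reflect = p := by
  induction p using nest_add_induction with
  | zero => simp
  | nest_add p q hp hq => rw [reflect_nest_add, reflect_nest_add, hp, hq]

theorem semilength_reflect (p : DyckWord) : p.reflect.semilength = p.semilength := by
  induction p using nest_add_induction with
  | zero => simp
  | nest_add p q hp hq => simp [reflect_nest_add, hp, hq]; ring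

theorem reflect_eq_zero {p : DyckWord} : p.reflect = 0 ↔ p = 0 := by
  constructor
  · intro h; rw [← reflect_reflect p, h, reflect_zero]
  · rintro rfl; exact reflect_zero

theorem valleyCount_add_peakCount_reflect (p : DyckWord) :
    p.valleyCount + p.reflect.peakCount = p.semilength := by
  induction p using nest_add_induction with
  | zero => simp
  | nest_add p q hp hq =>
    rw [reflect_nest_add, valleyCount_nest_add, peakCount_add, peakCount_nest, semilength_add,
      semilength_nest, ← hp, ← hq]
    simp only [reflect_eq_zero]
    split_ifs <;> ring

/-- Reflection as a permutation of the Dyck words of a given semilength. -/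
def reflectEquiv (n : ℕ) :
    {p : DyckWord // p.semilength = n} ≃ {p : DyckWord // p.semilength = n} where
  toFun p := ⟨p.1.reflect, by rw [semilength_reflect, p.2]⟩
  invFun p := ⟨p.1.reflect, by rw [semilength_reflect, p.2]⟩
  left_inv p := Subtype.ext (reflect_reflect p.1)
  right_inv p := Subtype.ext (reflect_reflect p.1)

end DyckWord

theorem isDyck_iff_count {m : ℕ} (P : Fin m → Bool) :
    IsDyck P ↔ 2 * (List.ofFn P).count true = m ∧
      ∀ k, ((List.ofFn P).take k).count false ≤ ((List.ofFn P).take k).count true := by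
  have htake (k : ℕ) (hk : m ≤ k) : (List.ofFn P).take k = List.ofFn P :=
    List.take_of_length_le (by simpa using hk)
  have htotal : (List.ofFn P).count true = (Finset.univ.filter fun i => P i = true).card := by
    rw [← htake m le_rfl, count_take_ofFn]
    simp
  have hprefix (c : Bool) (j : Fin m) : ((List.ofFn P).take (j + 1)).count c =
      (Finset.univ.filter fun i => i ≤ j ∧ P i = c).card := by
    rw [count_take_ofFn]
    simp only [Nat.lt_succ_iff, Fin.val_fin_le]
  rw [IsDyck, htotal]
  refine and_congr_right fun _ => ⟨fun h k => ?_, fun h j => ?_⟩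
  · wlog hk : k ≤ m generalizing k
    · rw [htake k (by omega), ← htake m le_rfl]
      exact this m le_rfl
    obtain _ | k := k
    · simp
    · simpa only [← hprefix] using h ⟨k, hk⟩
  · simpa only [← hprefix] using h (j + 1)

theorem count_true_add_count_false (l : List Bool) : l.count true + l.count false = l.length := by
  simp

theorem count_map_ofBool (l : List Bool) (b : Bool) :
    (l.map DyckStep.ofBool).count (DyckStep.ofBool b) = l.count b :=
  List.count_map_of_injective l _ DyckStep.ofBool_injective b

/-- The Dyck word with the same steps as a Dyck path. -/
def IsDyck.toDyckWord {m : ℕ} {P : Fin m → Bool} (h : IsDyck P) : DyckWord where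
  toList := (List.ofFn P).map DyckStep.ofBool
  count_U_eq_count_D := by
    have h1 := ((isDyck_iff_count P).1 h).1
    have h2 := count_true_add_count_false (List.ofFn P)
    rw [List.length_ofFn] at h2
    have := count_map_ofBool (List.ofFn P) true
    have := count_map_ofBool (List.ofFn P) false
    simp only [DyckStep.ofBool, if_true, Bool.false_eq_true, if_false] at *
    omega
  count_D_le_count_U k := by
    rw [← List.map_take]
    have h1 := ((isDyck_iff_count P).1 h).2 k
    rw [← count_map_ofBool, ← count_map_ofBool _ true] at h1
    exact h1

theorem IsDyck.semilength_toDyckWord {m : ℕ} {P : Fin (2 * m) → Bool} (h : IsDyck P) :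
    h.toDyckWord.semilength = m := by
  have := h.toDyckWord.two_mul_semilength_eq_length
  simp only [IsDyck.toDyckWord, List.length_map, List.length_ofFn] at this ⊢
  omega

theorem IsDyck.valleyCount_toDyckWord {m : ℕ} {P : Fin m → Bool} (h : IsDyck P) :
    h.toDyckWord.valleyCount = valleys P := by
  rw [DyckWord.valleyCount, toDyckWord, countAdj_map, valleys, ← countAdj_ofFn fun x y => !x && y]
  congr 1
  ext x y
  cases x <;> cases y <;> rfl

theorem IsDyck.peakCount_toDyckWord {m : ℕ} {P : Fin m → Bool} (h : IsDyck P) :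
    h.toDyckWord.peakCount = peaks P := by
  rw [DyckWord.peakCount, toDyckWord, countAdj_map, peaks, ← countAdj_ofFn fun x y => x && !y]
  congr 1
  ext x y
  cases x <;> cases y <;> rfl

theorem exists_map_ofBool_ofFn (p : DyckWord) {m : ℕ} (hp : p.toList.length = m) :
    ∃ P : Fin m → Bool, IsDyck P ∧ (List.ofFn P).map DyckStep.ofBool = p.toList := by
  subst hp
  set P : Fin p.toList.length → Bool := fun i => p.toList.get i == DyckStep.U with hP
  have hmap : (List.ofFn P).map DyckStep.ofBool = p.toList := by
    rw [List.map_ofFn]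
    conv_rhs => rw [← List.ofFn_get p.toList]
    congr 1
    ext i
    rcases h : p.toList.get i <;> simp_all [DyckStep.ofBool]
  refine ⟨P, (isDyck_iff_count P).2 ⟨?_, fun k => ?_⟩, hmap⟩
  · rw [← count_map_ofBool, hmap]
    exact p.two_mul_semilength_eq_length
  · rw [← count_map_ofBool, ← count_map_ofBool _ true, List.map_take, hmap]
    exact p.count_D_le_count_U k

theorem bijective_toDyckWord (m : ℕ) :
    Function.Bijective fun P : {P : Fin (2 * m) → Bool // IsDyck P} =>
      (⟨P.2.toDyckWord, P.2.semilength_toDyckWord⟩ : {p : DyckWord // p.semilength = m}) := by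
  constructor
  · intro P Q h
    have h' := congrArg (fun p => p.1.toList) h
    exact Subtype.ext (List.ofFn_injective (DyckStep.ofBool_injective.list_map h'))
  · rintro ⟨p, hp⟩
    obtain ⟨P, hP, h⟩ := exists_map_ofBool_ofFn p (m := 2 * m)
      (by rw [← p.two_mul_semilength_eq_length, hp])
    exact ⟨⟨P, hP⟩, Subtype.ext (DyckWord.ext h)⟩

theorem sum_isDyck_eq_sum_dyckWord (m : ℕ) (f : ℕ → ℕ → ℝ) :
    ∑ P ∈ Finset.univ.filter (fun P : Fin (2 * m) → Bool => IsDyck P), f (valleys P) (peaks P) =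
      ∑ p : {p : DyckWord // p.semilength = m}, f p.1.valleyCount p.1.peakCount := by
  rw [Finset.sum_subtype (p := IsDyck) _ (by simp)]
  refine Fintype.sum_bijective _ (bijective_toDyckWord m) _ _ fun P => ?_
  rw [P.2.valleyCount_toDyckWord, P.2.peakCount_toDyckWord]

/-- `Σ_{P ∈ D_n} a^{U_V(P)}·b^{V(P)} = Σ_{P ∈ D_n} a^{K(P)}·b^{U_K(P)}`, where
`U_V(P) = (n−1) − V(P)` and `U_K(P) = (n−1) − K(P)`. -/
theorem valley_sum_eq_peak_sum (a b : ℝ) (n : ℕ) (hn : 1 ≤ n) :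
    ∑ P ∈ Finset.univ.filter (fun P : Fin (2 * (n - 1)) → Bool => IsDyck P),
        a ^ ((n - 1) - valleys P) * b ^ valleys P
      = ∑ P ∈ Finset.univ.filter (fun P : Fin (2 * (n - 1)) → Bool => IsDyck P),
          a ^ peaks P * b ^ ((n - 1) - peaks P) := by
  rw [sum_isDyck_eq_sum_dyckWord (n - 1) fun v _ => a ^ ((n - 1) - v) * b ^ v,
    sum_isDyck_eq_sum_dyckWord (n - 1) fun _ k => a ^ k * b ^ ((n - 1) - k)]
  refine Fintype.sum_equiv (DyckWord.reflectEquiv (n - 1)) _ _ fun p => ?_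
  have h := p.1.valleyCount_add_peakCount_reflect
  rw [p.2] at h
  change _ = a ^ p.1.reflect.peakCount * b ^ ((n - 1) - p.1.reflect.peakCount)
  rw [show n - 1 - p.1.valleyCount = p.1.reflect.peakCount by omega,
    show n - 1 - p.1.reflect.peakCount = p.1.valleyCount by omega]
end

section
/- For all integers k, ℓ ≥ 1 and n ≥ 1, the number of colored Dyck paths of length 2(n−1) with k types of up steps U_1, …, U_k and ℓ types of down steps D_1, …, D_ℓ (i.e., lists over the type Fin k ⊕ Fin ℓ, where inl entries are up steps and inr entries are down steps, with equally many up and down entries, every prefix containing at least as many up as down entries) that contain no occurrence of U_1 immediately followed by D_1, equals s_{kℓ−1}(n). -/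
open scoped Classical

/-- A colored Dyck path of length `2(n−1)` with `k` types of up steps and `ℓ` types of
down steps, encoded as `P : Fin (2(n−1)) → Fin k ⊕ Fin ℓ` (`inl` = up, `inr` = down):
equally many up and down entries, every prefix has at least as many up as down entries. -/
def IsColoredDyck {m k l : ℕ} (P : Fin m → Fin k ⊕ Fin l) : Prop :=
  2 * (Finset.univ.filter fun i => (P i).isLeft = true).card = m ∧
  ∀ j : Fin m,
    (Finset.univ.filter fun i => i ≤ j ∧ (P i).isRight = true).card ≤
      (Finset.univ.filter fun i => i ≤ j ∧ (P i).isLeft = true).card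

open Polynomial in
/-- The kernel `φ = (1 + u)(d + (d + 1)u)` of the functional equation `G = x φ(G)`. -/
noncomputable def dyckKernel (d : ℝ) : ℝ[X] :=
  (1 + X) * (C d * (1 + X) + X)

open Polynomial in
/-- The coefficient of `x ^ j` in `(1 + G) ^ h`, where `G = x φ(G)`, in the derivative form of
the Lagrange inversion formula. -/
noncomputable def dyckCoeff (d : ℝ) (h : ℕ) : ℕ → ℝ
  | 0 => 1
  | j + 1 => ((1 + X) ^ h * dyckKernel d ^ j *
      (dyckKernel d - X * derivative (dyckKernel d))).coeff (j + 1)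

open Polynomial in
theorem coeff_pow_mul_sub_X_mul_derivative (φ : ℝ[X]) (j i : ℕ) :
    ((j : ℝ) + 1) * (φ ^ j * (φ - X * derivative φ)).coeff i =
      ((j : ℝ) + 1 - i) * (φ ^ (j + 1)).coeff i := by
  have e : C ((j : ℝ) + 1) * (φ ^ j * (φ - X * derivative φ)) =
      C ((j : ℝ) + 1) * φ ^ (j + 1) - X * derivative (φ ^ (j + 1)) := by
    rw [derivative_pow]
    push_cast
    simp only [map_add, map_one, map_natCast]
    ring
  have e' := congrArg (fun p => coeff p i) e
  simp only [coeff_C_mul, coeff_sub] at e'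
  rw [e']
  cases i with
  | zero => simp
  | succ i =>
    rw [coeff_X_mul, coeff_derivative]
    push_cast
    ring

open Polynomial in
theorem dyckCoeff_zero_succ (d : ℝ) (j : ℕ) : dyckCoeff d 0 (j + 1) = 0 := by
  have := coeff_pow_mul_sub_X_mul_derivative (dyckKernel d) j (j + 1)
  push_cast at this
  rw [sub_self, zero_mul] at this
  simp only [dyckCoeff, pow_zero, one_mul]
  exact (mul_eq_zero.mp this).resolve_left (by positivity)

open Polynomial in
theorem dyckCoeff_succ_succ (d : ℝ) (h j : ℕ) :
    dyckCoeff d (h + 1) (j + 1) =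
      dyckCoeff d h (j + 1) + (d + 1) * dyckCoeff d (h + 2) j - dyckCoeff d (h + 1) j := by
  have hX : ∀ p : ℝ[X], ∀ q : ℝ[X], ((1 + X) ^ (h + 1) * p * q).coeff (j + 1) =
      ((1 + X) ^ h * p * q).coeff (j + 1) + ((1 + X) ^ h * p * q).coeff j := by
    intro p q
    rw [← coeff_X_mul ((1 + X) ^ h * p * q) j, ← coeff_add]
    congr 1
    ring
  rw [dyckCoeff, hX, dyckCoeff]
  suffices ((1 + X) ^ h * dyckKernel d ^ j *
      (dyckKernel d - X * derivative (dyckKernel d))).coeff j =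
      (d + 1) * dyckCoeff d (h + 2) j - dyckCoeff d (h + 1) j by linarith
  cases j with
  | zero => simp [dyckCoeff, dyckKernel, coeff_zero_eq_eval_zero]
  | succ j =>
    rw [dyckCoeff, dyckCoeff, ← coeff_C_mul, ← coeff_sub]
    congr 1
    rw [pow_succ (dyckKernel d) j]
    generalize dyckKernel d - X * derivative (dyckKernel d) = ψ
    generalize hp : dyckKernel d ^ j = p
    simp only [dyckKernel, C_add, C_1]
    ring

open Polynomial in
theorem dyckCoeff_one (d : ℝ) (j : ℕ) :
    dyckCoeff d 1 (j + 1) = 1 / ((j : ℝ) + 1) * (dyckKernel d ^ (j + 1)).coeff j := by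
  have h0 := dyckCoeff_zero_succ d j
  have hj := coeff_pow_mul_sub_X_mul_derivative (dyckKernel d) j j
  simp only [dyckCoeff, pow_zero, one_mul, pow_one, mul_assoc, add_mul, coeff_add,
    coeff_X_mul] at h0 ⊢
  rw [h0, zero_add]
  field_simp
  linarith

open Polynomial in
theorem coeff_dyckKernel_pow (d : ℝ) (j : ℕ) :
    (dyckKernel d ^ (j + 1)).coeff j =
      ∑ k ∈ Finset.range (j + 2),
        ((j + 1).choose k : ℝ) * ((j + 1 + k).choose (j + 2)) * d ^ k := by
  rw [dyckKernel, mul_pow, add_pow (C d * (1 + X)), Finset.mul_sum, finsetSum_coeff]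
  refine Finset.sum_congr rfl fun k hk => ?_
  have hk' : k ≤ j + 1 := by simpa [Nat.lt_succ_iff] using hk
  have e : ((1 : ℝ[X]) + X) ^ (j + 1) *
      ((C d * (1 + X)) ^ k * X ^ (j + 1 - k) * ((j + 1).choose k : ℝ[X])) =
      C (((j + 1).choose k : ℝ) * d ^ k) * ((1 + X) ^ (j + 1 + k) * X ^ (j + 1 - k)) := by
    simp only [map_mul, map_pow, map_natCast, mul_pow]
    ring
  rw [e, coeff_C_mul, coeff_mul_X_pow']
  cases k with
  | zero => simp
  | succ k =>
    rw [if_pos (by omega), coeff_one_add_X_pow,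
      Nat.choose_symm_of_eq_add (show j + 1 + (k + 1) = (j - (j + 1 - (k + 1))) + (j + 2) by omega)]
    ring

theorem dyckCoeff_one_eq_sd (d : ℝ) (j : ℕ) : dyckCoeff d 1 j = sd d (j + 1) := by
  cases j with
  | zero => simp [dyckCoeff, sd, schroederS]
  | succ j =>
    rw [dyckCoeff_one, coeff_dyckKernel_pow, sd, Finset.mul_sum]
    refine Finset.sum_congr rfl fun k _ => ?_
    rw [schroederS, if_neg (by omega), show j + 1 + 1 - 1 = j + 1 by omega,
      show j + 1 + 1 + k - 1 = j + 1 + k by omega]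
    push_cast
    ring

/-- Words from height `h` down to `0` staying nonnegative and avoiding `U₁D₁`; when `b` holds, they
may also not begin with `D₁`. -/
def IsAvoidingFrom {m K L : ℕ} (h : ℕ) (b : Prop) (P : Fin m → Fin (K + 1) ⊕ Fin (L + 1)) : Prop :=
  (Finset.univ.filter fun i => (P i).isRight = true).card =
      h + (Finset.univ.filter fun i => (P i).isLeft = true).card ∧
  (∀ j : Fin m,
    (Finset.univ.filter fun i => i ≤ j ∧ (P i).isRight = true).card ≤
      h + (Finset.univ.filter fun i => i ≤ j ∧ (P i).isLeft = true).card) ∧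
  (∀ i : Fin m, ∀ hi : (i : ℕ) + 1 < m,
    ¬(P i = Sum.inl 0 ∧ P ⟨(i : ℕ) + 1, hi⟩ = Sum.inr 0)) ∧
  (b → ∀ hm : 0 < m, P ⟨0, hm⟩ ≠ Sum.inr 0)

theorem isAvoidingFrom_cons_inl {m K L : ℕ} (h : ℕ) (b : Prop) (x : Fin (K + 1))
    (P : Fin m → Fin (K + 1) ⊕ Fin (L + 1)) :
    IsAvoidingFrom h b (Fin.cons (Sum.inl x) P : Fin (m + 1) → Fin (K + 1) ⊕ Fin (L + 1)) ↔
      IsAvoidingFrom (h + 1) (x = 0) P := by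
  simp only [IsAvoidingFrom, Fin.card_filter_univ_succ, Fin.forall_fin_succ]
  simp
  constructor
  · rintro ⟨h₁, h₂, h₃, h₄⟩
    exact ⟨by omega, fun j => (h₂ j).trans (by omega), h₄, fun hx hm => h₃ hm hx⟩
  · rintro ⟨h₁, h₂, h₃, h₄⟩
    exact ⟨by omega, fun j => (h₂ j).trans (by omega), fun hm hx => h₄ hx hm, h₃⟩

theorem isAvoidingFrom_cons_inr {m K L : ℕ} (h : ℕ) (b : Prop) (y : Fin (L + 1))
    (P : Fin m → Fin (K + 1) ⊕ Fin (L + 1)) :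
    IsAvoidingFrom h b (Fin.cons (Sum.inr y) P : Fin (m + 1) → Fin (K + 1) ⊕ Fin (L + 1)) ↔
      0 < h ∧ ¬ (b ∧ y = 0) ∧ IsAvoidingFrom (h - 1) False P := by
  simp only [IsAvoidingFrom, Fin.card_filter_univ_succ, Fin.forall_fin_succ]
  simp
  constructor
  · rintro ⟨h₁, ⟨h₀, h₂⟩, h₃, h₄⟩
    refine ⟨h₀, h₄, by omega, fun j => ?_, h₃⟩
    have := h₂ j
    omega
  · rintro ⟨h₀, h₄, h₁, h₂, h₃⟩
    refine ⟨by omega, ⟨h₀, fun j => ?_⟩, h₃, h₄⟩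
    have := h₂ j
    omega

/-- The number of words in `IsAvoidingFrom`. -/
noncomputable def avoidingCount (K L m h : ℕ) (b : Prop) : ℕ :=
  (Finset.univ.filter fun P : Fin m → Fin (K + 1) ⊕ Fin (L + 1) => IsAvoidingFrom h b P).card

theorem avoidingCount_zero (K L h : ℕ) (b : Prop) :
    avoidingCount K L 0 h b = if h = 0 then 1 else 0 := by
  rcases eq_or_ne h 0 with rfl | hh
  · simp [avoidingCount, IsAvoidingFrom]
  · simp [avoidingCount, IsAvoidingFrom, hh, hh.symm]

theorem avoidingCount_succ (K L m h : ℕ) (b : Prop) :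
    avoidingCount K L (m + 1) h b =
      avoidingCount K L m (h + 1) True + K * avoidingCount K L m (h + 1) False +
      if 0 < h then ((if b then 0 else 1) + L) * avoidingCount K L m (h - 1) False else 0 := by
  have e : ∀ (h : ℕ) (b : Prop),
      (Finset.univ.filter fun P : Fin m → Fin (K + 1) ⊕ Fin (L + 1) =>
        IsAvoidingFrom h b P).card = avoidingCount K L m h b := fun _ _ => rfl
  have hc : ∀ x P, Fin.consEquiv (fun _ : Fin (m + 1) => Fin (K + 1) ⊕ Fin (L + 1)) (x, P) =
      Fin.cons x P := fun _ _ => rfl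
  rw [avoidingCount, Finset.card_filter,
    ← (Fin.consEquiv fun _ : Fin (m + 1) => Fin (K + 1) ⊕ Fin (L + 1)).sum_comp,
    Fintype.sum_prod_type, Fintype.sum_sum_type]
  simp only [hc, isAvoidingFrom_cons_inl, isAvoidingFrom_cons_inr, Fin.sum_univ_succ]
  by_cases hh : 0 < h <;> by_cases hb : b <;>
    simp [hh, hb, e] <;> ring

theorem avoidingCount_eq_zero (K L : ℕ) {m h : ℕ} (b : Prop) (hm : m < h) :
    avoidingCount K L m h b = 0 := by
  induction m generalizing h b with
  | zero => simp [avoidingCount_zero, Nat.ne_of_gt hm]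
  | succ m ih =>
    rw [avoidingCount_succ, ih _ (by omega), ih _ (by omega), ih (h := h - 1) _ (by omega)]
    simp

theorem avoidingCount_eq_dyckCoeff (K L m : ℕ) :
    (∀ h j, m = h + 2 * j → (avoidingCount K L m h False : ℝ) =
      ((L : ℝ) + 1) ^ h * dyckCoeff (((K : ℝ) + 1) * (L + 1) - 1) (h + 1) j) ∧
    (∀ h j, m = h + 1 + 2 * j → (avoidingCount K L m (h + 1) True : ℝ) =
      ((L : ℝ) + 1) ^ (h + 1) * dyckCoeff (((K : ℝ) + 1) * (L + 1) - 1) (h + 2) j -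
      ((L : ℝ) + 1) ^ h * dyckCoeff (((K : ℝ) + 1) * (L + 1) - 1) (h + 1) j) := by
  induction m with
  | zero =>
    refine ⟨fun h j e => ?_, fun h j e => by omega⟩
    obtain rfl : h = 0 := by omega
    obtain rfl : j = 0 := by omega
    simp [avoidingCount_zero, dyckCoeff]
  | succ m ih =>
    obtain ⟨ih₁, ih₂⟩ := ih
    have up : ∀ h j, m = h + 1 + 2 * j →
        (avoidingCount K L m (h + 1) True : ℝ) + K * avoidingCount K L m (h + 1) False =
        ((L : ℝ) + 1) ^ h * (dyckCoeff (((K : ℝ) + 1) * (L + 1) - 1) (h + 1) (j + 1) -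
          dyckCoeff (((K : ℝ) + 1) * (L + 1) - 1) h (j + 1)) := by
      intro h j e
      rw [ih₂ h j e, ih₁ (h + 1) j e, dyckCoeff_succ_succ]
      ring
    constructor
    · rintro (_ | h) (_ | j) e
      · omega
      · rw [avoidingCount_succ]
        push_cast
        rw [up 0 j (by omega), dyckCoeff_zero_succ]
        simp
      · rw [avoidingCount_succ, avoidingCount_eq_zero _ _ _ (by omega),
          avoidingCount_eq_zero _ _ _ (by omega)]
        push_cast
        simp only [Nat.succ_pos, if_true]
        rw [ih₁ h 0 (by omega)]
        simp only [dyckCoeff]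
        ring
      · rw [avoidingCount_succ]
        push_cast
        rw [up (h + 1) j (by omega)]
        simp only [Nat.succ_pos, if_true]
        rw [ih₁ h (j + 1) (by omega)]
        ring
    · rintro h (_ | j) e
      · rw [avoidingCount_succ, avoidingCount_eq_zero _ _ _ (by omega),
          avoidingCount_eq_zero _ _ _ (by omega)]
        push_cast
        simp only [Nat.succ_pos, if_true]
        rw [ih₁ h 0 (by omega)]
        simp only [dyckCoeff]
        ring
      · rw [avoidingCount_succ]
        push_cast
        rw [up (h + 1) j (by omega)]
        simp only [Nat.succ_pos, if_true]
        rw [ih₁ h (j + 1) (by omega)]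
        ring

theorem isAvoidingFrom_zero_iff {m K L : ℕ} (P : Fin m → Fin (K + 1) ⊕ Fin (L + 1)) :
    IsAvoidingFrom 0 False P ↔ IsColoredDyck P ∧ ∀ i : Fin m, ∀ hi : (i : ℕ) + 1 < m,
      ¬(P i = Sum.inl 0 ∧ P ⟨(i : ℕ) + 1, hi⟩ = Sum.inr 0) := by
  have hc : (Finset.univ.filter fun i => (P i).isLeft = true).card +
      (Finset.univ.filter fun i => (P i).isRight = true).card = m := by
    have := Finset.card_filter_add_card_filter_not (s := (Finset.univ : Finset (Fin m)))
      (fun i => (P i).isLeft = true)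
    simpa using this
  simp only [IsAvoidingFrom, IsColoredDyck, zero_add, false_imp_iff, and_true, and_assoc]
  refine and_congr_left fun _ => ?_
  omega

/-- The number of colored Dyck paths of length `2(n−1)` with `k` types of up steps,
`ℓ` types of down steps, avoiding the peak `U₁D₁`, equals `s_{kℓ−1}(n)`. -/
theorem colored_dyck_avoiding_count (k l n : ℕ) (hk : 1 ≤ k) (hl : 1 ≤ l) (hn : 1 ≤ n) :
    ((Finset.univ.filter fun P : Fin (2 * (n - 1)) → Fin k ⊕ Fin l =>
        IsColoredDyck P ∧
        ∀ i : Fin (2 * (n - 1)), ∀ h : (i : ℕ) + 1 < 2 * (n - 1),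
          ¬(P i = Sum.inl (⟨0, hk⟩ : Fin k) ∧
            P ⟨(i : ℕ) + 1, h⟩ = Sum.inr (⟨0, hl⟩ : Fin l))).card : ℝ)
      = sd ((k : ℝ) * (l : ℝ) - 1) n := by
  obtain ⟨K, rfl⟩ := Nat.exists_eq_add_of_le' hk
  obtain ⟨L, rfl⟩ := Nat.exists_eq_add_of_le' hl
  obtain ⟨j, rfl⟩ := Nat.exists_eq_add_of_le' hn
  have key := (avoidingCount_eq_dyckCoeff K L (2 * (j + 1 - 1))).1 0 j (by omega)
  simp only [avoidingCount, isAvoidingFrom_zero_iff, pow_zero, one_mul, zero_add,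
    dyckCoeff_one_eq_sd] at key
  push_cast
  exact key
end
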